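/- Let r > 0, θ ∈ ℝ, σ > 0, and let h : ℝ → ℝ be Lipschitz with constant L ≥ 0. Let f_h be the solution of the VG(r,θ,σ,0) Stein equation with test function h. Then for every x ≠ 0, every function g : ℝ → ℝ such that f_h has derivative g(y) at every y ≠ 0 in some neighborhood of x, and every d ∈ ℝ such that g has derivative d at x, one has |x·d| ≤ (2√(θ²+σ²)/σ²)·(1 + 6/(r+1) + B(r+1,θ,σ))·{1 + (2 + θ²/σ²)·C(r,θ,σ)}·L. -/

import Mathlib

open MeasureTheory Real Filter

/-- Modified Bessel function of the second kind. -/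
noncomputable def besselK (ν x : ℝ) : ℝ :=
  ∫ t in Set.Ioi (0:ℝ), Real.exp (-x * Real.cosh t) * Real.cosh (ν * t)

/-- Modified Bessel function of the first kind. -/
noncomputable def besselI (ν x : ℝ) : ℝ :=
  ∑' k : ℕ, (x / 2) ^ (ν + 2 * (k : ℝ)) / (Real.Gamma (ν + (k : ℝ) + 1) * (Nat.factorial k))

/-- The VG(r,θ,σ,0) density. -/
noncomputable def vgDensity (r θ σ x : ℝ) : ℝ :=
  (σ * Real.sqrt Real.pi * Real.Gamma (r / 2))⁻¹ * Real.exp (θ * x / σ ^ 2) *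
    (|x| / (2 * Real.sqrt (θ ^ 2 + σ ^ 2))) ^ ((r - 1) / 2) *
    besselK ((r - 1) / 2) (Real.sqrt (θ ^ 2 + σ ^ 2) * |x| / σ ^ 2)

/-- The centred test function h̃(x) = h(x) − E h(Z). -/
noncomputable def htilde (r θ σ : ℝ) (h : ℝ → ℝ) (x : ℝ) : ℝ :=
  h x - ∫ t, h t * vgDensity r θ σ t

/-- The solution of the VG(r,θ,σ,0) Stein equation with test function h. -/
noncomputable def steinSolution (r θ σ : ℝ) (h : ℝ → ℝ) (x : ℝ) : ℝ :=
  -(Real.exp (-(θ / σ ^ 2) * x) *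
      besselK ((r - 1) / 2) (Real.sqrt (θ ^ 2 + σ ^ 2) / σ ^ 2 * |x|) /
      (σ ^ 2 * |x| ^ ((r - 1) / 2))) *
    (∫ t in (0:ℝ)..x, Real.exp ((θ / σ ^ 2) * t) * |t| ^ ((r - 1) / 2) *
      besselI ((r - 1) / 2) (Real.sqrt (θ ^ 2 + σ ^ 2) / σ ^ 2 * |t|) * htilde r θ σ h t) -
  (Real.exp (-(θ / σ ^ 2) * x) *
      besselI ((r - 1) / 2) (Real.sqrt (θ ^ 2 + σ ^ 2) / σ ^ 2 * |x|) /
      (σ ^ 2 * |x| ^ ((r - 1) / 2))) *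
    (∫ t in Set.Ioi x, Real.exp ((θ / σ ^ 2) * t) * |t| ^ ((r - 1) / 2) *
      besselK ((r - 1) / 2) (Real.sqrt (θ ^ 2 + σ ^ 2) / σ ^ 2 * |t|) * htilde r θ σ h t)

/-- The constant A(r,θ,σ). -/
noncomputable def Aconst (r θ σ : ℝ) : ℝ :=
  if 2 ≤ r then 2 * Real.sqrt Real.pi / Real.sqrt (2 * r - 1) * (1 + θ ^ 2 / σ ^ 2) ^ (r / 2)
  else 12 * Real.Gamma (r / 2) * (1 + θ ^ 2 / σ ^ 2)

/-- The constant B(r,θ,σ). -/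
noncomputable def Bconst (r θ σ : ℝ) : ℝ :=
  if 2 ≤ r then Real.sqrt (Real.pi * (r - 1) / 2) * (1 + θ ^ 2 / σ ^ 2) ^ (r / 2 - 1)
  else 2

/-- The constant C(r,θ,σ). -/
noncomputable def Cconst (r θ σ : ℝ) : ℝ :=
  6 + 2 * Real.sqrt 2 / Real.sqrt r +
    2 * Real.sqrt (2 * Real.pi * (r + 1)) * (|θ| / σ) * (1 + θ ^ 2 / σ ^ 2) ^ ((r - 1) / 2) +
    2 * (Real.sqrt (2 * r) + r) * Aconst r θ σ

/-- FTC on `(0,∞)` with limits at both ends. -/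
theorem ftc_Ioi_lim {f f' : ℝ → ℝ} {l m : ℝ}
    (hd : ∀ x ∈ Set.Ioi (0:ℝ), HasDerivAt f (f' x) x)
    (hi : IntegrableOn f' (Set.Ioi (0:ℝ)))
    (h0 : Tendsto f (nhdsWithin 0 (Set.Ioi 0)) (nhds l))
    (h1 : Tendsto f atTop (nhds m)) : ∫ x in Set.Ioi (0:ℝ), f' x = m - l := by
  have key := integral_Ioi_of_hasDerivAt_of_tendsto (f := Function.update f 0 l) (f' := f') (a := 0)
    (m := m) ?_ ?_ hi ?_
  · simpa using key
  · rw [continuousWithinAt_update_same]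
    convert h0 using 2
    ext x; simp
  · intro x hx
    have hx0 : (0:ℝ) < x := hx
    refine (hd x hx).congr_of_eventuallyEq ?_
    filter_upwards [eventually_ne_nhds hx0.ne'] with y hy
    simp [Function.update_of_ne hy]
  · refine h1.congr' ?_
    filter_upwards [eventually_gt_atTop (0:ℝ)] with y hy
    simp [Function.update_of_ne hy.ne']

/-- The integral `∫_0^∞ s^(μ-1) exp(-s - y/s) ds`. -/
noncomputable def kap (μ y : ℝ) : ℝ :=
  ∫ s in Set.Ioi (0:ℝ), s ^ (μ - 1) * Real.exp (-s - y / s)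

theorem gam_int {μ : ℝ} (hμ : 0 < μ) :
    IntegrableOn (fun s : ℝ => s ^ (μ - 1) * Real.exp (-s)) (Set.Ioi 0) := by
  have := Real.GammaIntegral_convergent hμ
  refine this.congr_fun (fun x _ => ?_) measurableSet_Ioi
  simp only []; ring

theorem kap_meas (μ y : ℝ) :
    AEStronglyMeasurable (fun s : ℝ => s ^ (μ - 1) * Real.exp (-s - y / s))
      (volume.restrict (Set.Ioi 0)) := by
  apply Measurable.aestronglyMeasurable
  fun_prop

theorem kap_bound (μ : ℝ) {y : ℝ} (hy : 0 < y) (n : ℕ) {s : ℝ} (hs : 0 < s) :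
    s ^ (μ - 1) * Real.exp (-s - y / s) ≤ (n.factorial / y ^ n) * (s ^ (μ + n - 1) * Real.exp (-s)) := by
  have h1 := Real.pow_div_factorial_le_exp (y / s) (by positivity) n
  have h2 : Real.exp (-(y / s)) ≤ n.factorial / y ^ n * s ^ n := by
    rw [Real.exp_neg, inv_le_comm₀ (Real.exp_pos _) (by positivity)]
    refine le_trans (le_of_eq ?_) h1
    rw [div_pow]
    field_simp
  have h3 : s ^ (μ + n - 1) = s ^ (μ - 1) * s ^ n := by
    rw [← Real.rpow_natCast s n, ← Real.rpow_add hs]; ring_nf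
  rw [sub_eq_add_neg (-s), Real.exp_add, h3]
  have := mul_le_mul_of_nonneg_left h2 (show 0 ≤ s ^ (μ - 1) * Real.exp (-s) by positivity)
  calc _ = s ^ (μ - 1) * Real.exp (-s) * Real.exp (-(y / s)) := by ring
    _ ≤ _ := this
    _ = _ := by ring

theorem kap_int (μ : ℝ) {y : ℝ} (hy : 0 < y) :
    IntegrableOn (fun s : ℝ => s ^ (μ - 1) * Real.exp (-s - y / s)) (Set.Ioi 0) := by
  obtain ⟨n, hn⟩ := exists_nat_gt (-μ)
  have hg := (gam_int (μ := μ + n) (by linarith)).const_mul (n.factorial / y ^ n)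
  refine Integrable.mono' hg (kap_meas μ y) ?_
  refine (ae_restrict_iff' measurableSet_Ioi).2 (ae_of_all _ fun s hs => ?_)
  have hs' : (0:ℝ) < s := hs
  rw [Real.norm_of_nonneg (by positivity)]
  exact kap_bound μ hy n hs'

theorem kap_hasDerivAt (μ : ℝ) {y : ℝ} (hy : 0 < y) :
    HasDerivAt (kap μ) (-kap (μ - 1) y) y := by
  have key := hasDerivAt_integral_of_dominated_loc_of_deriv_le (μ := volume.restrict (Set.Ioi (0:ℝ)))
    (F := fun y s => s ^ (μ - 1) * Real.exp (-s - y / s)) (x₀ := y) (s := Set.Ioi (y / 2))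
    (F' := fun y s => -(s ^ (μ - 1 - 1) * Real.exp (-s - y / s)))
    (bound := fun s => s ^ (μ - 1 - 1) * Real.exp (-s - (y / 2) / s))
    (Ioi_mem_nhds (by linarith)) (Eventually.of_forall fun y => kap_meas μ y) (kap_int μ hy)
    (kap_meas (μ - 1) y).neg ?_ (kap_int (μ - 1) (by linarith)) ?_
  · have h2 := key.2
    rw [integral_neg] at h2
    exact h2
  · refine (ae_restrict_iff' measurableSet_Ioi).2 (ae_of_all _ fun s hs z hz => ?_)
    have hs' : (0:ℝ) < s := hs
    have hz' : y / 2 < z := hz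
    rw [norm_neg, Real.norm_of_nonneg (by positivity)]
    gcongr
  · refine (ae_restrict_iff' measurableSet_Ioi).2 (ae_of_all _ fun s hs z hz => ?_)
    have hs' : (0:ℝ) < s := hs
    have h1 : HasDerivAt (fun z : ℝ => -s - z / s) (-(1 / s)) z := by
      simpa using ((hasDerivAt_id z).div_const s).const_sub (-s)
    have h2 := (h1.exp).const_mul (s ^ (μ - 1))
    refine h2.congr_deriv ?_
    rw [Real.rpow_sub_one hs'.ne' (μ - 1)]
    field_simp

theorem kap_rec (μ : ℝ) {y : ℝ} (hy : 0 < y) :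
    kap (μ + 1) y = μ * kap μ y + y * kap (μ - 1) y := by
  have hd : ∀ s ∈ Set.Ioi (0:ℝ), HasDerivAt (fun s : ℝ => s ^ (μ + 1 - 1) * Real.exp (-s - y / s))
      (μ * (s ^ (μ - 1) * Real.exp (-s - y / s)) + y * (s ^ (μ - 1 - 1) * Real.exp (-s - y / s))
        - s ^ (μ + 1 - 1) * Real.exp (-s - y / s)) s := by
    intro s hs
    have hs' : (0:ℝ) < s := hs
    have h1 := Real.hasDerivAt_rpow_const (x := s) (p := μ + 1 - 1) (Or.inl hs'.ne')
    have h2 : HasDerivAt (fun s : ℝ => -s - y / s) (-1 - (-(y) / s ^ 2)) s := by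
      have h3 : HasDerivAt (fun s : ℝ => y / s) (-(y) / s ^ 2) s := by
        have := (hasDerivAt_const s y).fun_div (hasDerivAt_id s) hs'.ne'
        refine this.congr_deriv ?_
        simp
      exact (hasDerivAt_id s).neg.sub h3
    have h4 := h1.mul h2.exp
    refine h4.congr_deriv ?_
    rw [Real.rpow_sub_one hs'.ne' (μ - 1), Real.rpow_sub_one hs'.ne' μ]
    simp only [add_sub_cancel_right]
    rw [Real.rpow_sub_one hs'.ne' μ]
    field_simp
    ring
  have i1 := (kap_int μ hy).const_mul μ
  have i2 := (kap_int (μ - 1) hy).const_mul y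
  have i3 := kap_int (μ + 1) hy
  have hi := (i1.add i2).sub i3
  have key := ftc_Ioi_lim (l := 0) (m := 0) hd hi ?_
    (tendsto_zero_of_hasDerivAt_of_integrableOn_Ioi hd hi i3)
  · rw [integral_sub, integral_add, integral_const_mul, integral_const_mul] at key
    · unfold kap; linarith
    · exact i1
    · exact i2
    · exact i1.add i2
    · exact i3
  · obtain ⟨n, hn⟩ := exists_nat_gt (-μ)
    have hlim : Tendsto (fun s : ℝ => (n.factorial / y ^ n) * (s ^ (μ + 1 + n - 1) * Real.exp (-s)))
        (nhdsWithin 0 (Set.Ioi 0)) (nhds 0) := by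
      have hc : ContinuousAt (fun s : ℝ => (n.factorial / y ^ n) * (s ^ (μ + 1 + n - 1) * Real.exp (-s))) 0 := by
        have : ContinuousAt (fun s : ℝ => s ^ (μ + 1 + n - 1)) 0 :=
          Real.continuousAt_rpow_const _ _ (Or.inr (by linarith))
        fun_prop
      have := hc.tendsto.mono_left (nhdsWithin_le_nhds (s := Set.Ioi 0))
      simpa [Real.zero_rpow (show μ + 1 + n - 1 ≠ 0 by linarith)] using this
    refine squeeze_zero' ?_ ?_ hlim
    · filter_upwards [self_mem_nhdsWithin] with s hs
      have hs' : (0:ℝ) < s := hs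
      positivity
    · filter_upwards [self_mem_nhdsWithin] with s hs
      exact kap_bound (μ + 1) hy n hs

/-- derivative of `kap ν` in the form needed -/
theorem kap_hasDerivAt' (μ : ℝ) {y : ℝ} (hy : 0 < y) :
    HasDerivAt (kap μ) ((μ * kap μ y - kap (μ + 1) y) / y) y := by
  refine (kap_hasDerivAt μ hy).congr_deriv ?_
  rw [kap_rec μ hy]; field_simp; ring

theorem kap_nonneg (μ y : ℝ) : 0 ≤ kap μ y := by
  refine setIntegral_nonneg measurableSet_Ioi fun s hs => ?_
  have hs' : (0:ℝ) < s := hs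
  positivity

theorem kap_tendsto {μ : ℝ} (hμ : 0 < μ) :
    Tendsto (kap μ) (nhdsWithin 0 (Set.Ioi 0)) (nhds (Real.Gamma μ)) := by
  have hG : Real.Gamma μ = ∫ s in Set.Ioi (0:ℝ), s ^ (μ - 1) * Real.exp (-s) := by
    rw [Real.Gamma_eq_integral hμ]
    refine setIntegral_congr_fun measurableSet_Ioi fun s _ => ?_
    exact mul_comm _ _
  rw [hG]
  refine tendsto_integral_filter_of_dominated_convergence
    (fun s : ℝ => s ^ (μ - 1) * Real.exp (-s)) (Eventually.of_forall fun y => kap_meas μ y) ?_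
    (gam_int hμ) ?_
  · filter_upwards [self_mem_nhdsWithin] with y hy
    refine (ae_restrict_iff' measurableSet_Ioi).2 (ae_of_all _ fun s hs => ?_)
    have hs' : (0:ℝ) < s := hs
    have hy' : (0:ℝ) < y := hy
    rw [Real.norm_of_nonneg (by positivity)]
    gcongr
    have : 0 < y / s := by positivity
    linarith
  · refine ae_of_all _ fun s => ?_
    have : Continuous (fun y : ℝ => s ^ (μ - 1) * Real.exp (-s - y / s)) := by fun_prop
    have := (this.tendsto 0).mono_left (nhdsWithin_le_nhds (s := Set.Ioi 0))
    simpa using this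

theorem sqrt_kap_tendsto {μ : ℝ} (hμ : -(1/2) < μ) :
    Tendsto (fun y => Real.sqrt y * kap μ y) (nhdsWithin 0 (Set.Ioi 0)) (nhds 0) := by
  have h0 : (0:ℝ) = ∫ s in Set.Ioi (0:ℝ), (0:ℝ) := by simp
  suffices hh : Tendsto (fun y => Real.sqrt y * kap μ y) (nhdsWithin 0 (Set.Ioi 0))
      (nhds (∫ s in Set.Ioi (0:ℝ), (0:ℝ))) by simpa using hh
  have : (fun y => Real.sqrt y * kap μ y) =
      fun y => ∫ s in Set.Ioi (0:ℝ), Real.sqrt y * (s ^ (μ - 1) * Real.exp (-s - y / s)) := by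
    ext y; rw [integral_const_mul]; rfl
  rw [this]
  refine tendsto_integral_filter_of_dominated_convergence
    (fun s : ℝ => s ^ (μ + 1/2 - 1) * Real.exp (-s))
    (Eventually.of_forall fun y => (kap_meas μ y).const_mul _) ?_
    (gam_int (by linarith)) ?_
  · filter_upwards [self_mem_nhdsWithin] with y hy
    refine (ae_restrict_iff' measurableSet_Ioi).2 (ae_of_all _ fun s hs => ?_)
    have hs' : (0:ℝ) < s := hs
    have hy' : (0:ℝ) < y := hy
    rw [Real.norm_of_nonneg (by positivity)]
    have h1 : Real.sqrt (y / s) * Real.exp (-(y / s)) ≤ 1 := by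
      rw [Real.exp_neg, ← div_eq_mul_inv, div_le_one (Real.exp_pos _)]
      have h2 := Real.add_one_le_exp (y / s)
      have h3 : 0 < y / s := by positivity
      have h4 := Real.sq_sqrt h3.le
      nlinarith [sq_nonneg (Real.sqrt (y / s) - 1)]
    have h5 : s ^ (μ + 1/2 - 1) = s ^ (μ - 1) * Real.sqrt s := by
      rw [Real.sqrt_eq_rpow, ← Real.rpow_add hs']; ring_nf
    have h6 : Real.sqrt y = Real.sqrt (y / s) * Real.sqrt s := by
      rw [← Real.sqrt_mul (by positivity)]; congr 1; field_simp
    rw [h5, h6, sub_eq_add_neg (-s), Real.exp_add]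
    calc _ = (Real.sqrt (y / s) * Real.exp (-(y / s))) * (s ^ (μ - 1) * Real.sqrt s * Real.exp (-s)) := by ring
      _ ≤ 1 * (s ^ (μ - 1) * Real.sqrt s * Real.exp (-s)) := by gcongr
      _ = _ := by ring
  · refine ae_of_all _ fun s => ?_
    have : Continuous (fun y : ℝ => Real.sqrt y * (s ^ (μ - 1) * Real.exp (-s - y / s))) := by fun_prop
    have := (this.tendsto 0).mono_left (nhdsWithin_le_nhds (s := Set.Ioi 0))
    simpa using this

/-- The entire function `∑ y^k / (Γ(ν+k+1) k!)`. -/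
noncomputable def Jf (ν y : ℝ) : ℝ :=
  ∑' k : ℕ, y ^ k / (Real.Gamma (ν + (k : ℝ) + 1) * (Nat.factorial k))

theorem gam_lower {ν : ℝ} (hν : -1 < ν) :
    ∃ C : ℝ, 0 < C ∧ ∀ k : ℕ, 1 / Real.Gamma (ν + (k:ℝ) + 1) ≤ C := by
  have g1 : 0 < Real.Gamma (ν + 1) := Real.Gamma_pos_of_pos (by linarith)
  have g2 : 0 < Real.Gamma (ν + 2) := Real.Gamma_pos_of_pos (by linarith)
  refine ⟨1 / Real.Gamma (ν + 1) + 1 / Real.Gamma (ν + 2), by positivity, ?_⟩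
  have hk : ∀ k : ℕ, Real.Gamma (ν + 2) ≤ Real.Gamma (ν + ((k:ℝ) + 1) + 1) := by
    intro k
    induction k with
    | zero => simp; ring_nf; rfl
    | succ k ih =>
      have h1 : Real.Gamma (ν + ((k:ℝ) + 1) + 1 + 1) = (ν + ((k:ℝ) + 1) + 1) * Real.Gamma (ν + ((k:ℝ) + 1) + 1) :=
        Real.Gamma_add_one (by have : (0:ℝ) ≤ k := k.cast_nonneg
                               linarith)
      push_cast
      rw [show ν + ((k:ℝ) + 1 + 1) + 1 = ν + ((k:ℝ) + 1) + 1 + 1 by ring, h1]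
      have : (0:ℝ) ≤ k := k.cast_nonneg
      nlinarith
  intro k
  rcases k with _ | k
  · simp; positivity
  · have h1 : 1 / Real.Gamma (ν + ((k:ℝ) + 1) + 1) ≤ 1 / Real.Gamma (ν + 2) :=
      one_div_le_one_div_of_le g2 (hk k)
    push_cast
    have : 0 < 1 / Real.Gamma (ν + 1) := by positivity
    linarith

theorem Jf_coeff_nonneg {ν : ℝ} (hν : -1 < ν) (k : ℕ) :
    0 < Real.Gamma (ν + (k : ℝ) + 1) :=
  Real.Gamma_pos_of_pos (by have : (0:ℝ) ≤ k := k.cast_nonneg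
                            linarith)

theorem Jf_summable {ν : ℝ} (hν : -1 < ν) (y : ℝ) :
    Summable fun k : ℕ => y ^ k / (Real.Gamma (ν + (k : ℝ) + 1) * (Nat.factorial k)) := by
  obtain ⟨C, hC, hb⟩ := gam_lower hν
  refine Summable.of_norm_bounded ((Real.summable_pow_div_factorial |y|).mul_left C) fun k => ?_
  have := Jf_coeff_nonneg hν k
  rw [Real.norm_eq_abs, abs_div, abs_pow, abs_of_pos (a := _ * _) (by positivity)]
  calc _ = 1 / Real.Gamma (ν + (k : ℝ) + 1) * (|y| ^ k / k.factorial) := by field_simp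
    _ ≤ _ := by gcongr; exact hb k

theorem Jf_hasDerivAt {ν : ℝ} (hν : -1 < ν) (y : ℝ) : HasDerivAt (Jf ν) (Jf (ν + 1) y) y := by
  obtain ⟨C, hC, hb⟩ := gam_lower (ν := ν + 1) (by linarith)
  set R := |y| + 1 with hR
  have hR0 : 0 < R := by positivity
  have hshift : ∀ (k : ℕ) (z : ℝ),
      ((k + 1 : ℕ) : ℝ) * z ^ (k + 1 - 1) / (Real.Gamma (ν + ((k + 1 : ℕ) : ℝ) + 1) * ((k + 1).factorial : ℝ))
      = z ^ k / (Real.Gamma (ν + 1 + (k : ℝ) + 1) * (k.factorial : ℝ)) := by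
    intro k z
    have := Jf_coeff_nonneg (ν := ν + 1) (by linarith) k
    rw [Nat.factorial_succ]
    push_cast
    rw [show ν + ((k:ℝ) + 1) + 1 = ν + 1 + k + 1 by ring]
    try simp only [Nat.add_sub_cancel]
    have : (k:ℝ) + 1 ≠ 0 := by positivity
    field_simp
  have hsum : Summable (fun k : ℕ => C * (k * R ^ (k - 1) / (k.factorial : ℝ))) := by
    refine Summable.mul_left C ?_
    rw [← summable_nat_add_iff 1]
    refine (Real.summable_pow_div_factorial R).congr fun k => ?_
    rw [Nat.factorial_succ]
    push_cast
    have : (k:ℝ) + 1 ≠ 0 := by positivity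
    try simp only [Nat.add_sub_cancel]
    field_simp
  have key := hasDerivAt_tsum_of_isPreconnected (𝕜 := ℝ) (F := ℝ)
    (g := fun (k : ℕ) z => z ^ k / (Real.Gamma (ν + (k : ℝ) + 1) * (Nat.factorial k)))
    (g' := fun (k : ℕ) z => (k : ℝ) * z ^ (k - 1) / (Real.Gamma (ν + (k : ℝ) + 1) * (Nat.factorial k)))
    (t := Metric.ball 0 R) (y₀ := y) (y := y) hsum Metric.isOpen_ball
    (convex_ball (0:ℝ) R).isPreconnected ?_ ?_ ?_ (Jf_summable hν y) ?_
  · refine key.congr_deriv ?_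
    have hs0 : Summable (fun k : ℕ => (k : ℝ) * y ^ (k - 1) / (Real.Gamma (ν + (k : ℝ) + 1) * (Nat.factorial k))) := by
      rw [← summable_nat_add_iff 1]
      exact (Jf_summable (ν := ν + 1) (by linarith) y).congr fun k => (hshift k y).symm
    rw [hs0.tsum_eq_zero_add]
    unfold Jf
    simp only [Nat.cast_zero, zero_mul, zero_div, zero_add]
    exact tsum_congr fun k => hshift k y
  · intro k z _
    exact (hasDerivAt_pow k z).div_const _
  · intro k z hz
    have hz' : |z| < R := by simpa using hz
    rcases k with _ | k
    · simp
    · rw [hshift]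
      have hp := Jf_coeff_nonneg (ν := ν + 1) (by linarith) k
      rw [Real.norm_eq_abs, abs_div, abs_pow, abs_of_pos (a := _ * _) (by positivity)]
      rw [Nat.factorial_succ]
      push_cast
      have : (k:ℝ) + 1 ≠ 0 := by positivity
      try simp only [Nat.add_sub_cancel]
      calc _ = 1 / Real.Gamma (ν + 1 + (k : ℝ) + 1) * (|z| ^ k / k.factorial) := by field_simp
        _ ≤ C * (R ^ k / k.factorial) := by
          gcongr
          exact hb k
        _ = _ := by field_simp
  · simp [hR]
  · simp [hR]

theorem Jf_rec {ν : ℝ} (hν : -1 < ν) (y : ℝ) :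
    Jf ν y = (ν + 1) * Jf (ν + 1) y + y * Jf (ν + 2) y := by
  have h1 := Jf_summable (ν := ν + 1) (by linarith) y
  have h2 := Jf_summable (ν := ν + 2) (by linarith) y
  have hsh : ∀ k : ℕ, ((k + 1 : ℕ) : ℝ) * (y ^ (k + 1) / (Real.Gamma (ν + 1 + ((k + 1 : ℕ) : ℝ) + 1) * ((k + 1).factorial : ℝ)))
      = y * (y ^ k / (Real.Gamma (ν + 2 + (k:ℝ) + 1) * (k.factorial : ℝ))) := by
    intro k
    have := Jf_coeff_nonneg (ν := ν + 2) (by linarith) k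
    rw [Nat.factorial_succ]
    push_cast
    rw [show ν + 1 + ((k:ℝ) + 1) + 1 = ν + 2 + k + 1 by ring]
    have : (k:ℝ) + 1 ≠ 0 := by positivity
    field_simp
    ring
  have hs : Summable fun k : ℕ => (k : ℝ) * (y ^ k / (Real.Gamma (ν + 1 + (k : ℝ) + 1) * (k.factorial : ℝ))) := by
    rw [← summable_nat_add_iff 1]
    exact (h2.mul_left y).congr fun k => (hsh k).symm
  have e2 : y * Jf (ν + 2) y = ∑' k : ℕ, (k : ℝ) * (y ^ k / (Real.Gamma (ν + 1 + (k : ℝ) + 1) * (k.factorial : ℝ))) := by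
    rw [hs.tsum_eq_zero_add]
    unfold Jf
    rw [← tsum_mul_left]
    simp only [Nat.cast_zero, zero_mul, zero_add]
    exact tsum_congr fun k => (hsh k).symm
  rw [e2]
  unfold Jf
  rw [← tsum_mul_left, ← (h1.mul_left (ν + 1)).tsum_add hs]
  refine tsum_congr fun k => ?_
  have hp := Jf_coeff_nonneg hν k
  have hk : (0:ℝ) ≤ k := k.cast_nonneg
  have hne : ν + (k:ℝ) + 1 ≠ 0 := by linarith
  rw [show ν + 1 + (k:ℝ) + 1 = (ν + k + 1) + 1 by ring, Real.Gamma_add_one hne]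
  field_simp
  ring

theorem Jf_zero {ν : ℝ} : Jf ν 0 = 1 / Real.Gamma (ν + 1) := by
  unfold Jf
  rw [tsum_eq_single 0]
  · simp
  · intro k hk; simp [hk]

theorem wronskian {ν : ℝ} (hν : -(1/2) < ν) {y : ℝ} (hy : 0 < y) :
    y * kap ν y * Jf (ν + 1) y + kap (ν + 1) y * Jf ν y = 1 := by
  set V : ℝ → ℝ := fun y => y * kap ν y * Jf (ν + 1) y + kap (ν + 1) y * Jf ν y with hV
  have hd : ∀ z ∈ Set.Ioi (0:ℝ), HasDerivAt V 0 z := by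
    intro z hz
    have hz' : (0:ℝ) < z := hz
    have h1 := ((hasDerivAt_id z).fun_mul (kap_hasDerivAt' ν hz')).fun_mul
      (Jf_hasDerivAt (ν := ν + 1) (by linarith) z)
    have h2 := (kap_hasDerivAt (ν + 1) hz').fun_mul (Jf_hasDerivAt (ν := ν) (by linarith) z)
    refine (h1.add h2).congr_deriv ?_
    rw [Jf_rec (ν := ν) (by linarith) z, show ν + 1 - 1 = ν by ring, show ν + 1 + 1 = ν + 2 by ring]
    simp only [id]
    field_simp
    ring
  have hconst : ∀ z ∈ Set.Ioi (0:ℝ), V z = V y := by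
    intro z hz
    exact (convex_Ioi (0:ℝ)).is_const_of_fderivWithin_eq_zero (𝕜 := ℝ)
      (fun w hw => (hd w hw).differentiableAt.differentiableWithinAt)
      (fun w hw => by
        have := (hd w hw).hasDerivWithinAt (s := Set.Ioi 0)
        have h3 := this.hasFDerivWithinAt.fderivWithin (isOpen_Ioi.uniqueDiffWithinAt hw)
        rw [h3]; ext; simp) hz hy
  have hlim : Tendsto V (nhdsWithin 0 (Set.Ioi 0)) (nhds (0 * Jf (ν + 1) 0 + Real.Gamma (ν + 1) * Jf ν 0)) := by
    have c1 : Tendsto (Jf (ν + 1)) (nhdsWithin 0 (Set.Ioi 0)) (nhds (Jf (ν + 1) 0)) :=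
      (Jf_hasDerivAt (ν := ν + 1) (by linarith) 0).continuousAt.tendsto.mono_left nhdsWithin_le_nhds
    have c2 : Tendsto (Jf ν) (nhdsWithin 0 (Set.Ioi 0)) (nhds (Jf ν 0)) :=
      (Jf_hasDerivAt (ν := ν) (by linarith) 0).continuousAt.tendsto.mono_left nhdsWithin_le_nhds
    have c3 : Tendsto (fun y => y * kap ν y) (nhdsWithin 0 (Set.Ioi 0)) (nhds 0) := by
      have s1 : Tendsto Real.sqrt (nhdsWithin 0 (Set.Ioi 0)) (nhds 0) := by
        have := (Real.continuous_sqrt.tendsto 0).mono_left (nhdsWithin_le_nhds (s := Set.Ioi 0))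
        simpa using this
      have := s1.mul (sqrt_kap_tendsto hν)
      simp only [mul_zero] at this
      refine this.congr' ?_
      filter_upwards [self_mem_nhdsWithin] with z hz
      have hz' : (0:ℝ) < z := hz
      rw [← mul_assoc, Real.mul_self_sqrt hz'.le]
    exact (c3.mul c1).add ((kap_tendsto (by linarith)).mul c2)
  have hlim2 : Tendsto V (nhdsWithin 0 (Set.Ioi 0)) (nhds (V y)) := by
    refine tendsto_const_nhds.congr' ?_
    filter_upwards [self_mem_nhdsWithin] with z hz
    exact (hconst z hz).symm
  have := tendsto_nhds_unique hlim2 hlim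
  rw [Jf_zero (ν := ν)] at this
  have hg : Real.Gamma (ν + 1) ≠ 0 := (Real.Gamma_pos_of_pos (by linarith)).ne'
  rw [mul_one_div_cancel hg] at this
  simpa [hV] using this

theorem besselI_eq (ν : ℝ) {x : ℝ} (hx : 0 < x) :
    besselI ν x = (x / 2) ^ ν * Jf ν (x ^ 2 / 4) := by
  unfold besselI Jf
  rw [← tsum_mul_left]
  refine tsum_congr fun k => ?_
  have h2 : (x / 2) ^ (2 * (k:ℝ)) = (x ^ 2 / 4) ^ k := by
    rw [show (2 * (k:ℝ)) = ((2 * k : ℕ) : ℝ) by push_cast; ring, Real.rpow_natCast, pow_mul]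
    congr 1; ring
  rw [Real.rpow_add (by positivity), h2]
  ring

theorem kap_sub (ν : ℝ) {x : ℝ} (hx : 0 < x) :
    kap ν (x ^ 2 / 4) = ∫ t : ℝ, (x / 2) ^ ν * (Real.exp (ν * t) * Real.exp (-x * Real.cosh t)) ∧
    Integrable (fun t : ℝ => (x / 2) ^ ν * (Real.exp (ν * t) * Real.exp (-x * Real.cosh t))) := by
  have himg : (fun t : ℝ => x / 2 * Real.exp t) '' Set.univ = Set.Ioi 0 := by
    ext s
    simp only [Set.image_univ, Set.mem_range, Set.mem_Ioi]
    constructor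
    · rintro ⟨t, rfl⟩; positivity
    · intro hs
      refine ⟨Real.log (s / (x / 2)), ?_⟩
      rw [Real.exp_log (by positivity)]; field_simp
  have hder : ∀ t ∈ Set.univ, HasDerivWithinAt (fun t : ℝ => x / 2 * Real.exp t) (x / 2 * Real.exp t) Set.univ t :=
    fun t _ => ((Real.hasDerivAt_exp t).const_mul (x / 2)).hasDerivWithinAt
  have hinj : Set.InjOn (fun t : ℝ => x / 2 * Real.exp t) Set.univ := by
    intro t _ t' _ h
    have : Real.exp t = Real.exp t' := mul_left_cancel₀ (by positivity) h
    exact Real.exp_injective this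
  have hfun : ∀ t : ℝ, |x / 2 * Real.exp t| • ((x / 2 * Real.exp t) ^ (ν - 1) *
      Real.exp (-(x / 2 * Real.exp t) - (x ^ 2 / 4) / (x / 2 * Real.exp t))) =
      (x / 2) ^ ν * (Real.exp (ν * t) * Real.exp (-x * Real.cosh t)) := by
    intro t
    have hp : 0 < x / 2 * Real.exp t := by positivity
    have h1 : (x / 2 * Real.exp t) * (x / 2 * Real.exp t) ^ (ν - 1) = (x / 2) ^ ν * Real.exp (ν * t) := by
      rw [Real.rpow_sub_one hp.ne', mul_div_cancel₀ _ hp.ne', Real.mul_rpow (by positivity) (Real.exp_pos _).le,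
        ← Real.exp_mul, mul_comm t]
    have h2 : -(x / 2 * Real.exp t) - (x ^ 2 / 4) / (x / 2 * Real.exp t) = -x * Real.cosh t := by
      rw [Real.cosh_eq, Real.exp_neg]; field_simp; ring
    rw [abs_of_pos hp, smul_eq_mul, ← mul_assoc, h1, h2]; ring
  have e1 := integral_image_eq_integral_abs_deriv_smul MeasurableSet.univ hder hinj
    (fun s => s ^ (ν - 1) * Real.exp (-s - (x ^ 2 / 4) / s))
  have e2 := integrableOn_image_iff_integrableOn_abs_deriv_smul MeasurableSet.univ hder hinj
    (fun s => s ^ (ν - 1) * Real.exp (-s - (x ^ 2 / 4) / s))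
  rw [himg] at e1 e2
  simp only [hfun] at e1 e2
  rw [setIntegral_univ] at e1
  rw [integrableOn_univ] at e2
  exact ⟨e1, e2.1 (kap_int ν (by positivity))⟩

theorem besselK_eq (ν : ℝ) {x : ℝ} (hx : 0 < x) :
    besselK ν x = (1/2) * (x / 2) ^ (-ν) * kap ν (x ^ 2 / 4) := by
  obtain ⟨h1, h2⟩ := kap_sub ν hx
  have hsplit : ∫ t : ℝ, (x / 2) ^ ν * (Real.exp (ν * t) * Real.exp (-x * Real.cosh t)) =
      2 * (x / 2) ^ ν * besselK ν x := by
    rw [← intervalIntegral.integral_Iic_add_Ioi (b := 0) h2.integrableOn h2.integrableOn]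
    have h3 := integral_comp_neg_Ioi (0:ℝ)
      (fun t : ℝ => (x / 2) ^ ν * (Real.exp (ν * t) * Real.exp (-x * Real.cosh t)))
    rw [neg_zero] at h3
    rw [← h3, ← integral_add]
    · unfold besselK
      rw [← integral_const_mul]
      refine setIntegral_congr_fun measurableSet_Ioi fun t _ => ?_
      simp only [Real.cosh_neg]
      rw [Real.cosh_eq (ν * t), mul_neg]
      ring
    · exact (h2.comp_neg).integrableOn
    · exact h2.integrableOn
  rw [h1, hsplit, Real.rpow_neg (by positivity)]
  have : (x / 2) ^ ν ≠ 0 := by positivity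
  field_simp

theorem gauss_lin (β : ℝ) {b : ℝ} (hb : 0 < b) :
    Integrable (fun t : ℝ => Real.exp (β * t - b * t ^ 2)) ∧
    ∫ t : ℝ, Real.exp (β * t - b * t ^ 2) = Real.sqrt (π / b) * Real.exp (β ^ 2 / (4 * b)) := by
  have hf : (fun t : ℝ => Real.exp (β * t - b * t ^ 2)) =
      fun t : ℝ => Real.exp (-b * (t - β / (2 * b)) ^ 2) * Real.exp (β ^ 2 / (4 * b)) := by
    ext t
    rw [← Real.exp_add]
    congr 1
    field_simp
    ring
  rw [hf]
  constructor
  · exact ((integrable_exp_neg_mul_sq hb).comp_sub_right (β / (2 * b))).mul_const _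
  · rw [integral_mul_const, integral_sub_right_eq_self (fun t => Real.exp (-b * t ^ 2)),
      integral_gaussian]

theorem kap_normal {ν α β : ℝ} (hν : -(1/2) < ν) (hα : 0 < α) (hβ : |β| < α) :
    Integrable (fun t : ℝ => Real.exp (β * t) * kap ν (α ^ 2 * t ^ 2 / 4)) ∧
    ∫ t : ℝ, Real.exp (β * t) * kap ν (α ^ 2 * t ^ 2 / 4) =
      2 * Real.sqrt π / α * ((1 / (1 - β ^ 2 / α ^ 2)) ^ (ν + 1/2) * Real.Gamma (ν + 1/2)) := by
  have hq : 0 < 1 - β ^ 2 / α ^ 2 := by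
    rw [sub_pos, div_lt_one (by positivity)]
    exact sq_lt_sq' (by linarith [neg_abs_le β]) (by linarith [le_abs_self β])
  set F : ℝ × ℝ → ℝ := fun p => Real.exp (β * p.1) * (p.2 ^ (ν - 1) * Real.exp (-p.2 - (α ^ 2 * p.1 ^ 2 / 4) / p.2)) with hF
  have hmeas : AEStronglyMeasurable F (volume.prod (volume.restrict (Set.Ioi (0:ℝ)))) := by
    apply Measurable.aestronglyMeasurable
    rw [hF]; fun_prop
  have hslice : ∀ s : ℝ, 0 < s → (fun t => F (t, s)) =
      fun t => s ^ (ν - 1) * Real.exp (-s) * Real.exp (β * t - (α ^ 2 / (4 * s)) * t ^ 2) := by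
    intro s hs
    ext t
    simp only [hF]
    rw [show s ^ (ν - 1) * Real.exp (-s) * Real.exp (β * t - (α ^ 2 / (4 * s)) * t ^ 2)
      = s ^ (ν - 1) * (Real.exp (-s) * Real.exp (β * t - (α ^ 2 / (4 * s)) * t ^ 2)) by ring,
      ← Real.exp_add, show Real.exp (β * t) * (s ^ (ν - 1) * Real.exp (-s - (α ^ 2 * t ^ 2 / 4) / s))
      = s ^ (ν - 1) * (Real.exp (β * t) * Real.exp (-s - (α ^ 2 * t ^ 2 / 4) / s)) by ring,
      ← Real.exp_add]
    congr 2
    field_simp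
    ring
  have hval : ∀ s : ℝ, 0 < s → ∫ t, F (t, s) =
      2 * Real.sqrt π / α * (s ^ (ν + 1/2 - 1) * Real.exp (-((1 - β ^ 2 / α ^ 2) * s))) := by
    intro s hs
    rw [hslice s hs, integral_const_mul, (gauss_lin β (b := α ^ 2 / (4 * s)) (by positivity)).2]
    have h1 : Real.sqrt (π / (α ^ 2 / (4 * s))) = 2 * Real.sqrt π / α * Real.sqrt s := by
      rw [show π / (α ^ 2 / (4 * s)) = (2 / α) ^ 2 * (π * s) by field_simp; ring,
        Real.sqrt_mul (by positivity), Real.sqrt_sq (by positivity), Real.sqrt_mul (by positivity)]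
      ring
    have h2 : s ^ (ν + 1/2 - 1) = s ^ (ν - 1) * Real.sqrt s := by
      rw [Real.sqrt_eq_rpow, ← Real.rpow_add hs]; ring_nf
    have h3 : Real.exp (-((1 - β ^ 2 / α ^ 2) * s)) = Real.exp (-s) * Real.exp (β ^ 2 / (4 * (α ^ 2 / (4 * s)))) := by
      rw [← Real.exp_add]; congr 1; field_simp; ring
    rw [h1, h2, h3]; ring
  have hFnn : ∀ s : ℝ, 0 < s → ∀ t, 0 ≤ F (t, s) := by
    intro s hs t; simp only [hF]; positivity
  have hgi : IntegrableOn (fun s : ℝ => 2 * Real.sqrt π / α * (s ^ (ν + 1/2 - 1) * Real.exp (-((1 - β ^ 2 / α ^ 2) * s)))) (Set.Ioi 0) := by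
    have := integrableOn_rpow_mul_exp_neg_mul_rpow (p := 1) (s := ν + 1/2 - 1) (by linarith) one_pos hq
    refine (IntegrableOn.congr_fun this (fun s _ => ?_) measurableSet_Ioi).const_mul _
    simp only [Real.rpow_one, neg_mul]
  have hFint : Integrable F (volume.prod (volume.restrict (Set.Ioi (0:ℝ)))) := by
    rw [integrable_prod_iff' hmeas]
    constructor
    · refine (ae_restrict_iff' measurableSet_Ioi).2 (ae_of_all _ fun s hs => ?_)
      have hs' : (0:ℝ) < s := hs
      rw [hslice s hs']
      exact (gauss_lin β (b := α ^ 2 / (4 * s)) (by positivity)).1.const_mul _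
    · refine IntegrableOn.congr_fun hgi (fun s hs => ?_) measurableSet_Ioi
      refine (hval s hs).symm.trans ?_
      exact integral_congr_ae (ae_of_all _ fun t => (Real.norm_of_nonneg (hFnn s hs t)).symm)
  have hk : ∀ t, ∫ s, F (t, s) ∂(volume.restrict (Set.Ioi (0:ℝ))) = Real.exp (β * t) * kap ν (α ^ 2 * t ^ 2 / 4) := by
    intro t
    simp only [hF]
    rw [integral_const_mul]; rfl
  constructor
  · have := hFint.integral_prod_left
    simpa only [hk] using this
  · have e := integral_integral_swap (f := fun t s => F (t, s)) hFint
    simp only [hk] at e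
    rw [e]
    rw [setIntegral_congr_fun measurableSet_Ioi (fun s hs => hval s hs), integral_const_mul,
      Real.integral_rpow_mul_exp_neg_mul_Ioi (by linarith) hq]

/-- integrability with a linear-growth weight -/
theorem kap_weight {ν α β : ℝ} (hν : -(1/2) < ν) (hα : 0 < α) (hβ : |β| < α) {w : ℝ → ℝ} {s : Set ℝ}
    (hs : MeasurableSet s) (hw : AEStronglyMeasurable w (volume.restrict s)) {C D : ℝ}
    (hb : ∀ t ∈ s, |w t| ≤ C + D * |t|) :
    IntegrableOn (fun t : ℝ => Real.exp (β * t) * kap ν (α ^ 2 * t ^ 2 / 4) * w t) s := by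
  set δ := (α - |β|) / 2 with hδ
  have hδ0 : 0 < δ := by rw [hδ]; linarith
  have h1 := (kap_normal (β := β + δ) hν hα (by
    rw [abs_lt]; constructor <;> linarith [neg_abs_le β, le_abs_self β])).1
  have h2 := (kap_normal (β := β - δ) hν hα (by
    rw [abs_lt]; constructor <;> linarith [neg_abs_le β, le_abs_self β])).1
  have h0 := (kap_normal hν hα hβ).1
  have hdom := ((h1.add h2).const_mul (|C| + |D| / δ))
  refine Integrable.mono' (hdom.integrableOn (s := s)) ?_ ?_
  · exact (h0.aestronglyMeasurable.restrict).mul hw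
  · refine (ae_restrict_iff' hs).2 (ae_of_all _ fun t ht => ?_)
    have hk := kap_nonneg ν (α ^ 2 * t ^ 2 / 4)
    have hE : (1 + δ * |t|) * Real.exp (β * t) ≤ Real.exp ((β + δ) * t) + Real.exp ((β - δ) * t) := by
      have e1 : 1 + δ * |t| ≤ Real.exp (δ * |t|) := by linarith [Real.add_one_le_exp (δ * |t|)]
      have e2 : Real.exp (δ * |t|) ≤ Real.exp (δ * t) + Real.exp (-δ * t) := by
        rcases abs_cases t with ⟨h, _⟩ | ⟨h, _⟩
        · rw [h]; linarith [Real.exp_pos (-δ * t)]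
        · rw [h]; have := Real.exp_pos (δ * t)
          rw [show δ * -t = -δ * t by ring]; linarith
      have e3 : Real.exp ((β + δ) * t) = Real.exp (δ * t) * Real.exp (β * t) := by
        rw [← Real.exp_add]; ring_nf
      have e4 : Real.exp ((β - δ) * t) = Real.exp (-δ * t) * Real.exp (β * t) := by
        rw [← Real.exp_add]; ring_nf
      rw [e3, e4, ← add_mul]
      exact mul_le_mul_of_nonneg_right (e1.trans e2) (Real.exp_pos _).le
    have hw' : |w t| ≤ (|C| + |D| / δ) * (1 + δ * |t|) := by
      have a1 := hb t ht
      have a2 : D * |t| ≤ |D| * |t| := mul_le_mul_of_nonneg_right (le_abs_self D) (abs_nonneg t)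
      have a3 := le_abs_self C
      have a4 : |D| / δ * (δ * |t|) = |D| * |t| := by field_simp
      have a5 : 0 ≤ |C| * (δ * |t|) := by positivity
      have a6 : 0 ≤ |D| / δ := by positivity
      nlinarith
    simp only [Pi.add_apply]
    rw [norm_mul, Real.norm_of_nonneg (by positivity), Real.norm_eq_abs]
    calc Real.exp (β * t) * kap ν (α ^ 2 * t ^ 2 / 4) * |w t|
        ≤ Real.exp (β * t) * kap ν (α ^ 2 * t ^ 2 / 4) * ((|C| + |D| / δ) * (1 + δ * |t|)) := by gcongr
      _ = (|C| + |D| / δ) * (((1 + δ * |t|) * Real.exp (β * t)) * kap ν (α ^ 2 * t ^ 2 / 4)) := by ring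
      _ ≤ (|C| + |D| / δ) * ((Real.exp ((β + δ) * t) + Real.exp ((β - δ) * t)) * kap ν (α ^ 2 * t ^ 2 / 4)) := by gcongr
      _ = _ := by ring

structure HalfLine (ν α β r M C D : ℝ) (f f1 f2 H : ℝ → ℝ) : Prop where
  hν : -(1/2) < ν
  hα : 0 < α
  hβ : |β| < α
  hr : r = 2 * ν + 1
  cf : Continuous f
  cf1 : Continuous f1
  bf : ∀ x, |f x| ≤ M
  bf1 : ∀ x, |f1 x| ≤ M
  d1 : ∀ x, 0 < x → HasDerivAt f (f1 x) x
  d2 : ∀ x, 0 < x → HasDerivAt f1 (f2 x) x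
  cH : Continuous H
  bH : ∀ t, |H t| ≤ C + D * |t|
  ode : ∀ x, 0 < x → x * f2 x + (r + 2 * β * x) * f1 x + (r * β + (β ^ 2 - α ^ 2) * x) * f x = H x

theorem deriv_y (α t : ℝ) : HasDerivAt (fun t : ℝ => α ^ 2 * t ^ 2 / 4) (α ^ 2 * t / 2) t := by
  have := ((hasDerivAt_pow 2 t).const_mul (α ^ 2)).div_const 4
  refine this.congr_deriv ?_
  simp; ring

theorem tendsto_y {α : ℝ} (hα : 0 < α) :
    Tendsto (fun t : ℝ => α ^ 2 * t ^ 2 / 4) (nhdsWithin 0 (Set.Ioi 0)) (nhdsWithin 0 (Set.Ioi 0)) := by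
  refine tendsto_nhdsWithin_of_tendsto_nhds_of_eventually_within _ ?_ ?_
  · have : Continuous (fun t : ℝ => α ^ 2 * t ^ 2 / 4) := by fun_prop
    have := (this.tendsto 0).mono_left (nhdsWithin_le_nhds (s := Set.Ioi 0))
    simpa using this
  · filter_upwards [self_mem_nhdsWithin] with t ht
    have ht' : (0:ℝ) < t := ht
    exact Set.mem_Ioi.2 (by positivity)

namespace HalfLine
variable {ν α β r M C D : ℝ} {f f1 f2 H : ℝ → ℝ}

theorem u_deriv (S : HalfLine ν α β r M C D f f1 f2 H) {t : ℝ} (ht : 0 < t) :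
    HasDerivAt (fun t => Real.exp (β * t) * f t) (Real.exp (β * t) * (f1 t + β * f t)) t := by
  have he : HasDerivAt (fun t : ℝ => Real.exp (β * t)) (Real.exp (β * t) * (β * 1)) t :=
    ((hasDerivAt_id t).const_mul β).exp
  refine (he.fun_mul (S.d1 t ht)).congr_deriv ?_
  ring

theorem u1_deriv (S : HalfLine ν α β r M C D f f1 f2 H) {t : ℝ} (ht : 0 < t) :
    HasDerivAt (fun t => Real.exp (β * t) * (f1 t + β * f t))
      (Real.exp (β * t) * (f2 t + 2 * β * f1 t + β ^ 2 * f t)) t := by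
  have he : HasDerivAt (fun t : ℝ => Real.exp (β * t)) (Real.exp (β * t) * (β * 1)) t :=
    ((hasDerivAt_id t).const_mul β).exp
  refine (he.fun_mul ((S.d2 t ht).fun_add ((S.d1 t ht).const_mul β))).congr_deriv ?_
  ring

theorem psi_deriv (S : HalfLine ν α β r M C D f f1 f2 H) {t : ℝ} (ht : 0 < t) :
    HasDerivAt (fun t => t * kap ν (α ^ 2 * t ^ 2 / 4) * (Real.exp (β * t) * (f1 t + β * f t))
      + 2 * kap (ν + 1) (α ^ 2 * t ^ 2 / 4) * (Real.exp (β * t) * f t))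
      (Real.exp (β * t) * kap ν (α ^ 2 * t ^ 2 / 4) * H t) t := by
  have hα := S.hα
  have hy : 0 < α ^ 2 * t ^ 2 / 4 := by positivity
  have k0 : HasDerivAt (fun t : ℝ => kap ν (α ^ 2 * t ^ 2 / 4)) _ t := HasDerivAt.comp (h₂ := kap ν) (h := fun t : ℝ => α ^ 2 * t ^ 2 / 4) t
    (kap_hasDerivAt' ν hy) (deriv_y α t)
  have k1 : HasDerivAt (fun t : ℝ => kap (ν + 1) (α ^ 2 * t ^ 2 / 4)) _ t := HasDerivAt.comp (h₂ := kap (ν + 1)) (h := fun t : ℝ => α ^ 2 * t ^ 2 / 4) t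
    (kap_hasDerivAt (ν + 1) hy) (deriv_y α t)
  have h := (((hasDerivAt_id t).fun_mul k0).fun_mul (S.u1_deriv ht)).fun_add
    ((k1.const_mul 2).fun_mul (S.u_deriv ht))
  refine h.congr_deriv ?_
  rw [← S.ode t ht, S.hr, show ν + 1 - 1 = ν by ring]
  simp only [id]
  field_simp
  ring

theorem integrableH (S : HalfLine ν α β r M C D f f1 f2 H) {s : Set ℝ} (hs : MeasurableSet s) :
    IntegrableOn (fun t => Real.exp (β * t) * kap ν (α ^ 2 * t ^ 2 / 4) * H t) s :=
  kap_weight S.hν S.hα S.hβ hs S.cH.aestronglyMeasurable (fun t _ => S.bH t)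

theorem psi_lim (S : HalfLine ν α β r M C D f f1 f2 H) :
    Tendsto (fun t => t * kap ν (α ^ 2 * t ^ 2 / 4) * (Real.exp (β * t) * (f1 t + β * f t))
      + 2 * kap (ν + 1) (α ^ 2 * t ^ 2 / 4) * (Real.exp (β * t) * f t)) atTop (nhds 0) := by
  refine tendsto_zero_of_hasDerivAt_of_integrableOn_Ioi (a := 0) (fun t ht => S.psi_deriv ht)
    (S.integrableH measurableSet_Ioi) ?_
  have cf := S.cf
  have cf1 := S.cf1
  have hM : 0 ≤ M := (abs_nonneg _).trans (S.bf 0)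
  have i1 := kap_weight S.hν S.hα S.hβ (w := fun t => t * (f1 t + β * f t)) (C := 0)
    (D := M + |β| * M) (s := Set.Ioi 0) measurableSet_Ioi
    (by apply Continuous.aestronglyMeasurable; fun_prop) (fun t _ => by
      rw [abs_mul, zero_add, mul_comm]
      gcongr
      refine (abs_add_le _ _).trans ?_
      rw [abs_mul]
      gcongr
      · exact S.bf1 t
      · exact S.bf t)
  have i2 := kap_weight (ν := ν + 1) (by linarith [S.hν]) S.hα S.hβ (w := f) (C := M)
    (D := 0) (s := Set.Ioi 0) measurableSet_Ioi
    (by apply Continuous.aestronglyMeasurable; fun_prop) (fun t _ => by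
      simpa using S.bf t)
  refine IntegrableOn.congr_fun (i1.add (i2.const_mul 2)) (fun t _ => ?_) measurableSet_Ioi
  simp only [Pi.add_apply]
  ring

theorem intB (S : HalfLine ν α β r M C D f f1 f2 H) {x : ℝ} (hx : 0 < x) :
    ∫ t in Set.Ioi x, Real.exp (β * t) * kap ν (α ^ 2 * t ^ 2 / 4) * H t =
    -(x * kap ν (α ^ 2 * x ^ 2 / 4) * (Real.exp (β * x) * (f1 x + β * f x))
      + 2 * kap (ν + 1) (α ^ 2 * x ^ 2 / 4) * (Real.exp (β * x) * f x)) := by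
  rw [integral_Ioi_of_hasDerivAt_of_tendsto' (fun t ht => S.psi_deriv (lt_of_lt_of_le hx ht))
    (S.integrableH measurableSet_Ioi) S.psi_lim]
  ring

theorem intC (S : HalfLine ν α β r M C D f f1 f2 H) :
    ∫ t in Set.Ioi 0, Real.exp (β * t) * kap ν (α ^ 2 * t ^ 2 / 4) * H t =
    -(2 * Real.Gamma (ν + 1) * f 0) := by
  have cf := S.cf
  have cf1 := S.cf1
  have hα := S.hα
  rw [ftc_Ioi_lim (l := 2 * Real.Gamma (ν + 1) * f 0) (m := 0) (fun t ht => S.psi_deriv ht)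
    (S.integrableH measurableSet_Ioi) ?_ S.psi_lim]
  · ring
  · have c1 : Tendsto (fun t => Real.exp (β * t) * (f1 t + β * f t)) (nhdsWithin 0 (Set.Ioi 0))
        (nhds (f1 0 + β * f 0)) := by
      have : Continuous (fun t => Real.exp (β * t) * (f1 t + β * f t)) := by fun_prop
      have := (this.tendsto 0).mono_left (nhdsWithin_le_nhds (s := Set.Ioi 0))
      simpa using this
    have c2 : Tendsto (fun t => Real.exp (β * t) * f t) (nhdsWithin 0 (Set.Ioi 0)) (nhds (f 0)) := by
      have : Continuous (fun t => Real.exp (β * t) * f t) := by fun_prop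
      have := (this.tendsto 0).mono_left (nhdsWithin_le_nhds (s := Set.Ioi 0))
      simpa using this
    have c3 : Tendsto (fun t => t * kap ν (α ^ 2 * t ^ 2 / 4)) (nhdsWithin 0 (Set.Ioi 0)) (nhds 0) := by
      have h := ((sqrt_kap_tendsto S.hν).comp (tendsto_y S.hα)).const_mul (2 / α)
      rw [mul_zero] at h
      refine h.congr' ?_
      filter_upwards [self_mem_nhdsWithin] with t ht
      have ht' : (0:ℝ) < t := ht
      simp only [Function.comp]
      rw [show α ^ 2 * t ^ 2 / 4 = (α * t / 2) ^ 2 by ring, Real.sqrt_sq (by positivity)]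
      field_simp
    have c4 := ((kap_tendsto (μ := ν + 1) (by linarith [S.hν])).comp (tendsto_y S.hα)).const_mul 2
    have := (c3.mul c1).add (c4.mul c2)
    simpa using this

theorem theta_deriv (S : HalfLine ν α β r M C D f f1 f2 H) {t : ℝ} (ht : 0 < t) :
    HasDerivAt (fun t => t ^ r * ((Real.exp (β * t) * (f1 t + β * f t)) * Jf ν (α ^ 2 * t ^ 2 / 4)
      - (Real.exp (β * t) * f t) * (α ^ 2 * t / 2 * Jf (ν + 1) (α ^ 2 * t ^ 2 / 4))))
      (Real.exp (β * t) * t ^ (2 * ν) * Jf ν (α ^ 2 * t ^ 2 / 4) * H t) t := by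
  have hα := S.hα
  have hν := S.hν
  have j0 : HasDerivAt (fun t : ℝ => Jf ν (α ^ 2 * t ^ 2 / 4)) _ t :=
    (Jf_hasDerivAt (ν := ν) (by linarith) _).comp t (deriv_y α t)
  have j1 : HasDerivAt (fun t : ℝ => Jf (ν + 1) (α ^ 2 * t ^ 2 / 4)) _ t :=
    (Jf_hasDerivAt (ν := ν + 1) (by linarith) _).comp t (deriv_y α t)
  have hp := Real.hasDerivAt_rpow_const (x := t) (p := r) (Or.inl ht.ne')
  have hl : HasDerivAt (fun t : ℝ => α ^ 2 * t / 2) (α ^ 2 * 1 / 2) t :=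
    ((hasDerivAt_id t).const_mul (α ^ 2)).div_const 2
  have h := hp.fun_mul (((S.u1_deriv ht).fun_mul j0).fun_sub ((S.u_deriv ht).fun_mul (hl.fun_mul j1)))
  refine h.congr_deriv ?_
  have e1 : t ^ r = t ^ (2 * ν) * t := by
    rw [S.hr, Real.rpow_add_one ht.ne']
  have e2 : t ^ (r - 1) = t ^ (2 * ν) := by rw [S.hr]; ring_nf
  rw [← S.ode t ht, e1, e2, show ν + 1 + 1 = ν + 2 by ring, S.hr]
  rw [Jf_rec (ν := ν) (by linarith) (α ^ 2 * t ^ 2 / 4)]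
  ring

theorem intA (S : HalfLine ν α β r M C D f f1 f2 H) {x : ℝ} (hx : 0 < x) :
    ∫ t in (0:ℝ)..x, Real.exp (β * t) * t ^ (2 * ν) * Jf ν (α ^ 2 * t ^ 2 / 4) * H t =
    x ^ r * ((Real.exp (β * x) * (f1 x + β * f x)) * Jf ν (α ^ 2 * x ^ 2 / 4)
      - (Real.exp (β * x) * f x) * (α ^ 2 * x / 2 * Jf (ν + 1) (α ^ 2 * x ^ 2 / 4))) := by
  have hν := S.hν
  have cf := S.cf
  have cf1 := S.cf1
  have cH := S.cH
  have hr : 0 < r := by rw [S.hr]; linarith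
  have cJ : Continuous (Jf ν) := continuous_iff_continuousAt.2 fun y =>
    (Jf_hasDerivAt (ν := ν) (by linarith) y).continuousAt
  have cJ1 : Continuous (Jf (ν + 1)) := continuous_iff_continuousAt.2 fun y =>
    (Jf_hasDerivAt (ν := ν + 1) (by linarith) y).continuousAt
  have cr : Continuous (fun t : ℝ => t ^ r) := Real.continuous_rpow_const hr.le
  rw [intervalIntegral.integral_eq_sub_of_hasDerivAt_of_le hx.le
    (f := fun t => t ^ r * ((Real.exp (β * t) * (f1 t + β * f t)) * Jf ν (α ^ 2 * t ^ 2 / 4)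
      - (Real.exp (β * t) * f t) * (α ^ 2 * t / 2 * Jf (ν + 1) (α ^ 2 * t ^ 2 / 4))))]
  · simp [Real.zero_rpow hr.ne']
  · apply Continuous.continuousOn
    fun_prop
  · intro t ht
    exact S.theta_deriv ht.1
  · have i1 : IntervalIntegrable (fun t : ℝ => t ^ (2 * ν)) volume 0 x :=
      intervalIntegral.intervalIntegrable_rpow' (by linarith)
    have c2 : Continuous (fun t => Real.exp (β * t) * Jf ν (α ^ 2 * t ^ 2 / 4) * H t) := by fun_prop
    have := i1.mul_continuousOn c2.continuousOn
    refine this.congr (fun t _ => ?_)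
    ring

theorem recover (S : HalfLine ν α β r M C D f f1 f2 H) {x : ℝ} (hx : 0 < x) :
    -(1/2) * (x ^ (-(2 * ν)) * kap ν (α ^ 2 * x ^ 2 / 4) *
      (∫ t in (0:ℝ)..x, Real.exp (β * t) * t ^ (2 * ν) * Jf ν (α ^ 2 * t ^ 2 / 4) * H t) +
      Jf ν (α ^ 2 * x ^ 2 / 4) *
      ∫ t in Set.Ioi x, Real.exp (β * t) * kap ν (α ^ 2 * t ^ 2 / 4) * H t) = Real.exp (β * x) * f x := by
  rw [S.intA hx, S.intB hx]
  have hα := S.hα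
  have hW := wronskian S.hν (y := α ^ 2 * x ^ 2 / 4) (by positivity)
  have e1 : x ^ (-(2 * ν)) * x ^ r = x := by
    rw [← Real.rpow_add hx, S.hr]; ring_nf; exact Real.rpow_one x
  set K0 := kap ν (α ^ 2 * x ^ 2 / 4)
  set K1 := kap (ν + 1) (α ^ 2 * x ^ 2 / 4)
  set J0 := Jf ν (α ^ 2 * x ^ 2 / 4)
  set J1 := Jf (ν + 1) (α ^ 2 * x ^ 2 / 4)
  set u := Real.exp (β * x) * f x
  set u1 := Real.exp (β * x) * (f1 x + β * f x)
  calc _ = -(1/2) * (K0 * (x ^ (-(2 * ν)) * x ^ r) * (u1 * J0 - u * (α ^ 2 * x / 2 * J1))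
        + J0 * (-(x * K0 * u1 + 2 * K1 * u))) := by ring
    _ = u * (α ^ 2 * x ^ 2 / 4 * K0 * J1 + K1 * J0) := by rw [e1]; ring
    _ = u := by rw [hW, mul_one]

end HalfLine

/-- The one sided exponential smoothing operator. -/
noncomputable def Pop (a : ℝ) (φ : ℝ → ℝ) (x : ℝ) : ℝ :=
  ∫ y in Set.Ioi (0:ℝ), Real.exp (-a * y) * φ (x + y)

theorem exp_neg_int {a : ℝ} (ha : 0 < a) (c : ℝ) :
    IntegrableOn (fun y : ℝ => Real.exp (-a * y)) (Set.Ioi c) := by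
  exact exp_neg_integrableOn_Ioi c ha

theorem Pop_integrable {a M : ℝ} (ha : 0 < a) {φ : ℝ → ℝ} (hm : Measurable φ)
    (hb : ∀ x, |φ x| ≤ M) (x c : ℝ) :
    IntegrableOn (fun y => Real.exp (-a * y) * φ (x + y)) (Set.Ioi c) := by
  refine Integrable.mul_bdd (c := M) (exp_neg_int ha c) ?_ ?_
  · exact (hm.comp (measurable_const_add x)).aestronglyMeasurable
  · exact ae_of_all _ fun y => hb _

theorem exp_neg_int_val {a : ℝ} (ha : 0 < a) :
    ∫ y in Set.Ioi (0:ℝ), Real.exp (-a * y) = 1 / a := by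
  rw [integral_exp_mul_Ioi (by linarith)]
  simp

theorem Pop_bound {a M : ℝ} (ha : 0 < a) {φ : ℝ → ℝ}
    (hb : ∀ x, |φ x| ≤ M) (x : ℝ) : |Pop a φ x| ≤ M / a := by
  have : ‖Pop a φ x‖ ≤ ∫ y in Set.Ioi (0:ℝ), Real.exp (-a * y) * M := by
    refine norm_integral_le_of_norm_le ((exp_neg_int ha 0).mul_const M) (ae_of_all _ fun y => ?_)
    rw [norm_mul, Real.norm_eq_abs, Real.norm_eq_abs, abs_of_pos (Real.exp_pos _)]
    gcongr
    exact hb _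
  rw [integral_mul_const, exp_neg_int_val ha] at this
  rw [Real.norm_eq_abs] at this
  calc _ ≤ _ := this
    _ = M / a := by ring

theorem Pop_sub {a M M' : ℝ} (ha : 0 < a) {φ ψ : ℝ → ℝ} (hm : Measurable φ)
    (hb : ∀ x, |φ x| ≤ M) (hm' : Measurable ψ) (hb' : ∀ x, |ψ x| ≤ M') (x : ℝ) :
    Pop a φ x - Pop a ψ x = Pop a (fun t => φ t - ψ t) x := by
  unfold Pop
  rw [← integral_sub (Pop_integrable ha hm hb x 0) (Pop_integrable ha hm' hb' x 0)]
  congr 1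
  ext y
  ring

theorem Pop_eq (a : ℝ) (φ : ℝ → ℝ) (x : ℝ) :
    Pop a φ x = Real.exp (a * x) * ∫ t in Set.Ioi x, Real.exp (-a * t) * φ t := by
  unfold Pop
  have := (measurePreserving_add_left volume x).setIntegral_preimage_emb
    (measurableEmbedding_addLeft x) (fun t => Real.exp (-a * t) * φ t) (Set.Ioi x)
  rw [Set.preimage_const_add_Ioi, sub_self] at this
  rw [← this, ← integral_const_mul]
  congr 1
  ext y
  rw [← mul_assoc, ← Real.exp_add]
  congr 2
  ring

theorem Pop_eq' {a M : ℝ} (ha : 0 < a) {φ : ℝ → ℝ} (hm : Measurable φ)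
    (hb : ∀ x, |φ x| ≤ M) (x : ℝ) :
    Pop a φ x = Real.exp (a * x) * ((∫ t in Set.Ioi 0, Real.exp (-a * t) * φ t) -
      ∫ t in (0:ℝ)..x, Real.exp (-a * t) * φ t) := by
  have hi : ∀ c, IntegrableOn (fun y => Real.exp (-a * y) * φ y) (Set.Ioi c) := fun c => by
    simpa using Pop_integrable ha hm hb 0 c
  rw [Pop_eq]
  congr 1
  rw [← intervalIntegral.integral_Ioi_sub_Ioi' (hi 0) (hi x)]
  ring

theorem Pop_ii {a M : ℝ} {φ : ℝ → ℝ} (ha : 0 < a) (hm : Measurable φ)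
    (hb : ∀ x, |φ x| ≤ M) (c d : ℝ) :
    IntervalIntegrable (fun t => Real.exp (-a * t) * φ t) volume c d := by
  have hi : ∀ c, IntegrableOn (fun y => Real.exp (-a * y) * φ y) (Set.Ioi c) := fun c => by
    simpa using Pop_integrable ha hm hb 0 c
  rw [intervalIntegrable_iff]
  exact (hi (min c d)).mono_set Set.Ioc_subset_Ioi_self

theorem Pop_cont {a M : ℝ} (ha : 0 < a) {φ : ℝ → ℝ} (hm : Measurable φ)
    (hb : ∀ x, |φ x| ≤ M) : Continuous (Pop a φ) := by
  have : Pop a φ = fun x => _ := funext (Pop_eq' ha hm hb)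
  rw [this]
  have c1 := intervalIntegral.continuous_primitive (Pop_ii ha hm hb) 0
  fun_prop

theorem Pop_deriv {a M : ℝ} (ha : 0 < a) {φ : ℝ → ℝ} (hm : Measurable φ)
    (hb : ∀ x, |φ x| ≤ M) {x : ℝ} (hc : ContinuousAt φ x) :
    HasDerivAt (Pop a φ) (a * Pop a φ x - φ x) x := by
  have e : Pop a φ = fun x => _ := funext (Pop_eq' ha hm hb)
  have h1 : HasDerivAt (fun u => ∫ t in (0:ℝ)..u, Real.exp (-a * t) * φ t)
      (Real.exp (-a * x) * φ x) x := by
    refine intervalIntegral.integral_hasDerivAt_right (Pop_ii ha hm hb 0 x) ?_ ?_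
    · refine ⟨Set.univ, univ_mem, ?_⟩
      apply Measurable.aestronglyMeasurable
      fun_prop
    · exact ContinuousAt.mul (by fun_prop) hc
  have he : HasDerivAt (fun t : ℝ => Real.exp (a * t)) (Real.exp (a * x) * (a * 1)) x :=
    ((hasDerivAt_id x).const_mul a).exp
  have h2 := he.fun_mul (h1.const_sub (∫ t in Set.Ioi 0, Real.exp (-a * t) * φ t))
  rw [← e] at h2
  refine h2.congr_deriv ?_
  rw [Pop_eq' ha hm hb]
  have : Real.exp (a * x) * Real.exp (-a * x) = 1 := by rw [← Real.exp_add]; simp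
  linear_combination (- φ x) * this

/-- Averaging operator. -/
noncomputable def Phi (r : ℝ) (m : ℝ → ℝ) (x : ℝ) : ℝ :=
  ∫ s in (0:ℝ)..1, s ^ (r - 1) * m (x * s)

/-- The difference quotient attached to the averaging operator. -/
noncomputable def phi (r : ℝ) (m : ℝ → ℝ) (x : ℝ) : ℝ := (m x - r * Phi r m x) / x

theorem pow_ii {r : ℝ} (hr : 0 < r) (x y : ℝ) :
    IntervalIntegrable (fun s : ℝ => s ^ (r - 1)) volume x y :=
  intervalIntegral.intervalIntegrable_rpow' (by linarith)

theorem pow_val {r : ℝ} (hr : 0 < r) : ∫ s in (0:ℝ)..1, s ^ (r - 1) = 1 / r := by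
  rw [integral_rpow (Or.inl (by linarith))]
  simp [Real.zero_rpow hr.ne']

theorem Phi_ii {r : ℝ} (hr : 0 < r) {m : ℝ → ℝ} (hm : Continuous m) (x : ℝ) :
    IntervalIntegrable (fun s : ℝ => s ^ (r - 1) * m (x * s)) volume 0 1 :=
  (pow_ii hr 0 1).mul_continuousOn (by fun_prop)

theorem pow_mul_val {r : ℝ} (hr : 0 < r) (c : ℝ) :
    ∫ s in (0:ℝ)..1, s ^ (r - 1) * (c * s) = c / (r + 1) := by
  have : ∫ s in (0:ℝ)..1, s ^ (r - 1) * (c * s) = ∫ s in (0:ℝ)..1, c * s ^ ((r + 1) - 1) := by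
    refine intervalIntegral.integral_congr_ae (ae_of_all _ fun s hs => ?_)
    rw [Set.uIoc_of_le zero_le_one] at hs
    rw [show r + 1 - 1 = (r - 1) + 1 by ring, Real.rpow_add_one hs.1.ne']
    ring
  rw [this, intervalIntegral.integral_const_mul, pow_val (by linarith)]
  ring

theorem lip_cont {m : ℝ → ℝ} {Λ : ℝ} (hm : ∀ u v, |m u - m v| ≤ Λ * |u - v|) : Continuous m := by
  have h0 : 0 ≤ Λ := by have := (abs_nonneg _).trans (hm 1 0); simpa using this
  have : LipschitzWith ⟨Λ, h0⟩ m := LipschitzWith.of_dist_le_mul fun u v => by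
    rw [Real.dist_eq, Real.dist_eq]; exact hm u v
  exact this.continuous

theorem Phi_lip {r Λ : ℝ} (hr : 0 < r) {m : ℝ → ℝ} (hm : ∀ u v, |m u - m v| ≤ Λ * |u - v|)
    (x y : ℝ) : |Phi r m x - Phi r m y| ≤ Λ / (r + 1) * |x - y| := by
  have hc := lip_cont hm
  unfold Phi
  rw [← intervalIntegral.integral_sub (Phi_ii hr hc x) (Phi_ii hr hc y)]
  have : ‖∫ s in (0:ℝ)..1, (s ^ (r - 1) * m (x * s) - s ^ (r - 1) * m (y * s))‖ ≤
      ∫ s in (0:ℝ)..1, s ^ (r - 1) * (Λ * |x - y| * s) := by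
    refine intervalIntegral.norm_integral_le_of_norm_le zero_le_one (ae_of_all _ fun s hs => ?_) ?_
    · rw [← mul_sub, norm_mul, Real.norm_eq_abs, Real.norm_eq_abs,
        abs_of_nonneg (Real.rpow_nonneg hs.1.le _)]
      gcongr
      · exact Real.rpow_nonneg hs.1.le _
      · refine (hm _ _).trans (le_of_eq ?_)
        rw [← sub_mul, abs_mul, abs_of_pos hs.1]; ring
    · exact (pow_ii hr 0 1).mul_continuousOn (by fun_prop)
  rw [pow_mul_val hr, Real.norm_eq_abs] at this
  calc _ ≤ _ := this
    _ = _ := by ring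

theorem m_sub_Phi {r Λ : ℝ} (hr : 0 < r) {m : ℝ → ℝ} (hm : ∀ u v, |m u - m v| ≤ Λ * |u - v|)
    (x : ℝ) : |m x - r * Phi r m x| ≤ Λ / (r + 1) * |x| := by
  have hc := lip_cont hm
  have e : m x - r * Phi r m x = r * ∫ s in (0:ℝ)..1, (s ^ (r - 1) * m x - s ^ (r - 1) * m (x * s)) := by
    rw [intervalIntegral.integral_sub ((pow_ii hr 0 1).mul_const _) (Phi_ii hr hc x),
      intervalIntegral.integral_mul_const, pow_val hr]
    unfold Phi
    field_simp
  rw [e, abs_mul, abs_of_pos hr]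
  have : ‖∫ s in (0:ℝ)..1, (s ^ (r - 1) * m x - s ^ (r - 1) * m (x * s))‖ ≤
      ∫ s in (0:ℝ)..1, (s ^ (r - 1) * (Λ * |x|) - s ^ (r - 1) * (Λ * |x| * s)) := by
    refine intervalIntegral.norm_integral_le_of_norm_le zero_le_one (ae_of_all _ fun s hs => ?_) ?_
    · rw [← mul_sub, ← mul_sub, norm_mul, Real.norm_eq_abs, Real.norm_eq_abs,
        abs_of_nonneg (Real.rpow_nonneg hs.1.le _)]
      gcongr
      · exact Real.rpow_nonneg hs.1.le _
      · refine (hm _ _).trans (le_of_eq ?_)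
        rw [show x - x * s = x * (1 - s) by ring, abs_mul, abs_of_nonneg (by linarith [hs.2] : 0 ≤ 1 - s)]
        ring
    · exact ((pow_ii hr 0 1).mul_const _).sub ((pow_ii hr 0 1).mul_continuousOn (by fun_prop))
  have e2 : ∫ s in (0:ℝ)..1, (s ^ (r - 1) * (Λ * |x|) - s ^ (r - 1) * (Λ * |x| * s)) =
      1 / r * (Λ * |x|) - Λ * |x| / (r + 1) := by
    rw [intervalIntegral.integral_sub ((pow_ii hr 0 1).mul_const _)
      ((pow_ii hr 0 1).mul_continuousOn (by fun_prop)), intervalIntegral.integral_mul_const,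
      pow_val hr, pow_mul_val hr]
  rw [e2, Real.norm_eq_abs] at this
  calc _ ≤ r * (1 / r * (Λ * |x|) - Λ * |x| / (r + 1)) := by gcongr
    _ = _ := by field_simp; ring

theorem mul_phi {r Λ : ℝ} (hr : 0 < r) {m : ℝ → ℝ} (hm : ∀ u v, |m u - m v| ≤ Λ * |u - v|)
    (x : ℝ) : x * phi r m x = m x - r * Phi r m x := by
  unfold phi
  rcases eq_or_ne x 0 with rfl | hx
  · have := m_sub_Phi hr hm 0
    simp only [abs_zero, mul_zero] at this
    rw [abs_nonpos_iff.1 this]; simp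
  · field_simp

theorem phi_bound {r Λ : ℝ} (hr : 0 < r) {m : ℝ → ℝ} (hm : ∀ u v, |m u - m v| ≤ Λ * |u - v|)
    (x : ℝ) : |phi r m x| ≤ Λ / (r + 1) := by
  have h0 : 0 ≤ Λ := by have := (abs_nonneg _).trans (hm 1 0); simpa using this
  unfold phi
  rw [abs_div]
  exact div_le_of_le_mul₀ (abs_nonneg _) (by positivity) (m_sub_Phi hr hm x)

theorem Phi_cont {r Λ : ℝ} (hr : 0 < r) {m : ℝ → ℝ} (hm : ∀ u v, |m u - m v| ≤ Λ * |u - v|) :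
    Continuous (Phi r m) := lip_cont (Phi_lip hr hm)

theorem phi_meas {r Λ : ℝ} (hr : 0 < r) {m : ℝ → ℝ} (hm : ∀ u v, |m u - m v| ≤ Λ * |u - v|) :
    Measurable (phi r m) := by
  have c1 := (lip_cont hm).measurable
  have c2 := (Phi_cont hr hm).measurable
  unfold phi
  fun_prop

theorem phi_contAt {r Λ : ℝ} (hr : 0 < r) {m : ℝ → ℝ} (hm : ∀ u v, |m u - m v| ≤ Λ * |u - v|)
    {x : ℝ} (hx : x ≠ 0) : ContinuousAt (phi r m) x := by
  have c1 := (lip_cont hm)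
  have c2 := (Phi_cont hr hm)
  unfold phi
  exact ContinuousAt.div (by fun_prop) (by fun_prop) hx

theorem Phi_deriv_pos {r : ℝ} (hr : 0 < r) {m : ℝ → ℝ} (hm : Continuous m)
    {x : ℝ} (hx : 0 < x) : HasDerivAt (Phi r m) (phi r m x) x := by
  have e : ∀ y, 0 < y → Phi r m y = y ^ (-r) * ∫ t in (0:ℝ)..y, t ^ (r - 1) * m t := by
    intro y hy
    have := intervalIntegral.mul_integral_comp_mul_left (a := 0) (b := 1)
      (f := fun t : ℝ => t ^ (r - 1) * m t) y
    rw [mul_zero, mul_one] at this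
    rw [← this, ← mul_assoc, ← Real.rpow_add_one hy.ne', ← intervalIntegral.integral_const_mul]
    unfold Phi
    refine intervalIntegral.integral_congr_ae (ae_of_all _ fun s hs => ?_)
    rw [Set.uIoc_of_le zero_le_one] at hs
    rw [Real.mul_rpow hy.le hs.1.le]
    have : y ^ (-r + 1) * y ^ (r - 1) = 1 := by
      rw [← Real.rpow_add hy]; simp
    linear_combination (- s ^ (r - 1) * m (y * s)) * this
  have h1 : HasDerivAt (fun u => ∫ t in (0:ℝ)..u, t ^ (r - 1) * m t) (x ^ (r - 1) * m x) x := by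
    refine intervalIntegral.integral_hasDerivAt_right
      ((pow_ii hr 0 x).mul_continuousOn (by fun_prop)) ?_ ?_
    · refine ⟨Set.univ, univ_mem, ?_⟩
      have := hm.measurable
      apply Measurable.aestronglyMeasurable
      fun_prop
    · exact ContinuousAt.mul (Real.continuousAt_rpow_const _ _ (Or.inl hx.ne')) hm.continuousAt
  have hp := Real.hasDerivAt_rpow_const (x := x) (p := -r) (Or.inl hx.ne')
  have h2 := hp.fun_mul h1
  have h3 : HasDerivAt (Phi r m) _ x := h2.congr_of_eventuallyEq
    (by filter_upwards [lt_mem_nhds hx] with y hy using e y hy)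
  refine h3.congr_deriv ?_
  unfold phi
  rw [e x hx, Real.rpow_sub_one hx.ne', Real.rpow_sub_one hx.ne']
  have : x ^ (-r) * x ^ r = 1 := by rw [← Real.rpow_add hx]; simp
  field_simp
  linear_combination (m x) * this

theorem Phi_neg (r : ℝ) (m : ℝ → ℝ) (x : ℝ) : Phi r m x = Phi r (fun t => m (-t)) (-x) := by
  unfold Phi; simp

theorem Phi_deriv {r : ℝ} (hr : 0 < r) {m : ℝ → ℝ} (hm : Continuous m)
    {x : ℝ} (hx : x ≠ 0) : HasDerivAt (Phi r m) (phi r m x) x := by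
  rcases lt_or_gt_of_ne hx with h | h
  · have h1 := Phi_deriv_pos hr (m := fun t => m (-t)) (by fun_prop) (x := -x) (by linarith)
    have h2 := HasDerivAt.comp (h₂ := Phi r (fun t => m (-t))) (h := fun t : ℝ => -t) x h1
      (hasDerivAt_neg x)
    have e : Phi r m = (Phi r (fun t => m (-t))) ∘ (fun t : ℝ => -t) := funext (Phi_neg r m)
    rw [e]
    refine h2.congr_deriv ?_
    unfold phi
    rw [← Phi_neg]
    simp only [neg_neg]
    field_simp
  · exact Phi_deriv_pos hr hm h

theorem phi_sub {r : ℝ} (hr : 0 < r) {m n : ℝ → ℝ} (hm : Continuous m) (hn : Continuous n)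
    (x : ℝ) : phi r m x - phi r n x = phi r (fun t => m t - n t) x := by
  have : Phi r (fun t => m t - n t) x = Phi r m x - Phi r n x := by
    unfold Phi
    rw [← intervalIntegral.integral_sub (Phi_ii hr hm x) (Phi_ii hr hn x)]
    congr 1; ext s; ring
  unfold phi
  rw [this]
  ring

/-- The primitive-perturbed test function. -/
noncomputable def mS (r : ℝ) (h S : ℝ → ℝ) (x : ℝ) : ℝ := h x + r / 2 * ∫ t in (0:ℝ)..x, S t

theorem prim_lip {S : ℝ → ℝ} (hS : Continuous S) {N : ℝ} (hN : ∀ x, |S x| ≤ N) (u v : ℝ) :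
    |(∫ t in (0:ℝ)..u, S t) - ∫ t in (0:ℝ)..v, S t| ≤ N * |u - v| := by
  rw [intervalIntegral.integral_interval_sub_left (hS.intervalIntegrable _ _)
    (hS.intervalIntegrable _ _)]
  exact intervalIntegral.norm_integral_le_of_norm_le_const (f := S) (fun t _ => hN t)

theorem mS_lip {r L N : ℝ} (hr : 0 < r) {h S : ℝ → ℝ} (hlip : ∀ u v : ℝ, |h u - h v| ≤ L * |u - v|)
    (hS : Continuous S) (hN : ∀ x, |S x| ≤ N) (u v : ℝ) :
    |mS r h S u - mS r h S v| ≤ (L + r / 2 * N) * |u - v| := by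
  unfold mS
  calc _ = |(h u - h v) + r / 2 * ((∫ t in (0:ℝ)..u, S t) - ∫ t in (0:ℝ)..v, S t)| := by
        congr 1; ring
    _ ≤ |h u - h v| + r / 2 * |(∫ t in (0:ℝ)..u, S t) - ∫ t in (0:ℝ)..v, S t| := by
        refine (abs_add_le _ _).trans ?_
        rw [abs_mul, abs_of_pos (by positivity : 0 < r / 2)]
    _ ≤ L * |u - v| + r / 2 * (N * |u - v|) := by
        gcongr
        · exact hlip u v
        · exact prim_lip hS hN u v
    _ = _ := by ring

/-- The symmetric smoothing. -/
noncomputable def TT (a b : ℝ) (φ : ℝ → ℝ) (x : ℝ) : ℝ :=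
  a * Pop a φ x + b * Pop b (fun t => φ (-t)) (-x)

theorem TT_bound {a b M : ℝ} (ha : 0 < a) (hb : 0 < b) {φ : ℝ → ℝ}
    (hM : ∀ x, |φ x| ≤ M) (x : ℝ) : |TT a b φ x| ≤ 2 * M := by
  have h1 := Pop_bound ha hM x
  have h2 := Pop_bound hb (φ := fun t => φ (-t)) (fun t => hM (-t)) (-x)
  unfold TT
  calc _ ≤ a * |Pop a φ x| + b * |Pop b (fun t => φ (-t)) (-x)| := by
        refine (abs_add_le _ _).trans ?_
        rw [abs_mul, abs_mul, abs_of_pos ha, abs_of_pos hb]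
    _ ≤ a * (M / a) + b * (M / b) := by gcongr
    _ = 2 * M := by field_simp; ring

theorem TT_cont {a b M : ℝ} (ha : 0 < a) (hb : 0 < b) {φ : ℝ → ℝ} (hm : Measurable φ)
    (hM : ∀ x, |φ x| ≤ M) : Continuous (TT a b φ) := by
  have h1 := Pop_cont ha hm hM
  have h2 := Pop_cont hb (φ := fun t => φ (-t)) (by fun_prop) (fun t => hM (-t))
  unfold TT
  fun_prop

theorem TT_sub {a b M M' : ℝ} (ha : 0 < a) (hb : 0 < b) {φ ψ : ℝ → ℝ} (hm : Measurable φ)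
    (hM : ∀ x, |φ x| ≤ M) (hm' : Measurable ψ) (hM' : ∀ x, |ψ x| ≤ M') (x : ℝ) :
    TT a b φ x - TT a b ψ x = TT a b (fun t => φ t - ψ t) x := by
  unfold TT
  rw [← Pop_sub ha hm hM hm' hM', ← Pop_sub hb (φ := fun t => φ (-t)) (ψ := fun t => ψ (-t))
    (by fun_prop) (fun t => hM (-t)) (by fun_prop) (fun t => hM' (-t))]
  ring

open BoundedContinuousFunction in
theorem exists_S {r a b L : ℝ} (hr : 0 < r) (ha : 0 < a) (hb : 0 < b) {h : ℝ → ℝ}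
    (hlip : ∀ u v : ℝ, |h u - h v| ≤ L * |u - v|) :
    ∃ S : BoundedContinuousFunction ℝ ℝ, ∀ x, S x = TT a b (phi r (mS r h S)) x := by
  have hL : 0 ≤ L := by have := (abs_nonneg _).trans (hlip 1 0); simpa using this
  have hN : ∀ (S : BoundedContinuousFunction ℝ ℝ) x, |S x| ≤ ‖S‖ := fun S x => S.norm_coe_le_norm x
  have hl := fun S : BoundedContinuousFunction ℝ ℝ => mS_lip hr hlip S.continuous (hN S)
  have hT : ∀ S : BoundedContinuousFunction ℝ ℝ, ∃ S' : BoundedContinuousFunction ℝ ℝ,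
      ∀ x, S' x = TT a b (phi r (mS r h S)) x := fun S =>
    ⟨BoundedContinuousFunction.ofNormedAddCommGroup _
      (TT_cont ha hb (phi_meas hr (hl S)) (phi_bound hr (hl S))) _
      (TT_bound ha hb (phi_bound hr (hl S))), fun x => rfl⟩
  choose T hT using hT
  have hK : ContractingWith (Real.toNNReal (r / (r + 1))) T := by
    refine ⟨?_, ?_⟩
    · rw [Real.toNNReal_lt_one, div_lt_one (by positivity)]; linarith
    · refine LipschitzWith.of_dist_le_mul fun S S' => ?_
      rw [Real.coe_toNNReal _ (by positivity)]
      rw [BoundedContinuousFunction.dist_le (by positivity)]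
      intro x
      rw [hT, hT, Real.dist_eq, TT_sub ha hb (phi_meas hr (hl S)) (phi_bound hr (hl S))
        (phi_meas hr (hl S')) (phi_bound hr (hl S'))]
      have hd : ∀ t, |S t - S' t| ≤ dist S S' := fun t => by
        rw [← Real.dist_eq]; exact BoundedContinuousFunction.dist_coe_le_dist t
      have hl2 : ∀ u v, |(mS r h S u - mS r h S' u) - (mS r h S v - mS r h S' v)| ≤
          (r / 2 * dist S S') * |u - v| := by
        intro u v
        have hp := prim_lip (S := fun t => S t - S' t) (by fun_prop) hd u v
        rw [intervalIntegral.integral_sub (S.continuous.intervalIntegrable _ _)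
          (S'.continuous.intervalIntegrable _ _), intervalIntegral.integral_sub
          (S.continuous.intervalIntegrable _ _) (S'.continuous.intervalIntegrable _ _)] at hp
        unfold mS
        calc _ = r / 2 * |((∫ t in (0:ℝ)..u, S t) - ∫ t in (0:ℝ)..u, S' t) -
              ((∫ t in (0:ℝ)..v, S t) - ∫ t in (0:ℝ)..v, S' t)| := by
              rw [← abs_of_pos (by positivity : 0 < r / 2), ← abs_mul,
                abs_of_pos (by positivity : 0 < r / 2)]
              congr 1; ring
          _ ≤ r / 2 * (dist S S' * |u - v|) := by gcongr
          _ = _ := by ring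
      refine (TT_bound ha hb (M := r / 2 * dist S S' / (r + 1)) (fun t => ?_) x).trans
        (le_of_eq (by ring))
      rw [phi_sub hr (lip_cont (hl S)) (lip_cont (hl S'))]
      exact phi_bound hr hl2 t
  exact ⟨hK.fixedPoint T, fun x => by rw [← hT]; rw [hK.fixedPoint_isFixedPt]⟩

/-- Reflected smoothing. -/
noncomputable def Rop (b : ℝ) (φ : ℝ → ℝ) (x : ℝ) : ℝ := Pop b (fun t => φ (-t)) (-x)

theorem Rop_cont {b M : ℝ} (hb : 0 < b) {φ : ℝ → ℝ} (hm : Measurable φ)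
    (hM : ∀ x, |φ x| ≤ M) : Continuous (Rop b φ) := by
  have h2 := Pop_cont hb (φ := fun t => φ (-t)) (by fun_prop) (fun t => hM (-t))
  unfold Rop
  fun_prop

theorem Rop_deriv {b M : ℝ} (hb : 0 < b) {φ : ℝ → ℝ} (hm : Measurable φ)
    (hM : ∀ x, |φ x| ≤ M) {x : ℝ} (hc : ContinuousAt φ x) :
    HasDerivAt (Rop b φ) (φ x - b * Rop b φ x) x := by
  have h1 := Pop_deriv hb (φ := fun t => φ (-t)) (by fun_prop) (fun t => hM (-t)) (x := -x)
    (by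
      refine ContinuousAt.comp (f := fun t : ℝ => -t) (g := φ) ?_ (by fun_prop)
      simpa using hc)
  have h2 := HasDerivAt.comp (h₂ := Pop b (fun t => φ (-t))) (h := fun t : ℝ => -t) x h1
      (hasDerivAt_neg x)
  refine h2.congr_deriv ?_
  unfold Rop
  simp only [neg_neg]
  ring

theorem const_of_deriv {q : ℝ → ℝ} (hq : Continuous q) (hd : ∀ x, x ≠ 0 → HasDerivAt q 0 x)
    (x : ℝ) : q x = q 0 := by
  have := MeasureTheory.integral_eq_of_hasDerivAt_off_countable q (fun _ => (0:ℝ)) (a := 0) (b := x)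
    (s := {0}) (Set.countable_singleton 0) hq.continuousOn (fun t ht => hd t (by simpa using ht.2))
    (by simp)
  simp at this
  linarith

theorem exists_phi {r a b L : ℝ} (hr : 0 < r) (ha : 0 < a) (hb : 0 < b) {h : ℝ → ℝ}
    (hlip : ∀ u v : ℝ, |h u - h v| ≤ L * |u - v|) :
    ∃ (φ : ℝ → ℝ) (c : ℝ), Measurable φ ∧ (∀ x, |φ x| ≤ L) ∧ (∀ x, x ≠ 0 → ContinuousAt φ x) ∧
      (∀ x y, |x * φ x - y * φ y| ≤ (2 * r + 1) * L * |x - y|) ∧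
      ∀ x, x * φ x + r / 2 * (Rop b φ x - Pop a φ x) = h x - c := by
  have hL : 0 ≤ L := by have := (abs_nonneg _).trans (hlip 1 0); simpa using this
  obtain ⟨S, hS⟩ := exists_S hr ha hb hlip
  have hl := mS_lip hr hlip S.continuous (fun x => S.norm_coe_le_norm x)
  set m := mS r h S with hm
  set φ := phi r m with hφ
  set Λ := L + r / 2 * ‖S‖ with hΛ
  have hMφ : ∀ x, |φ x| ≤ Λ / (r + 1) := phi_bound hr hl
  have hΛ0 : 0 ≤ Λ := by positivity
  have hSn : ‖S‖ ≤ 2 * (Λ / (r + 1)) := by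
    rw [BoundedContinuousFunction.norm_le (by positivity)]
    intro x
    rw [hS]
    exact TT_bound ha hb hMφ x
  have hle : Λ / (r + 1) ≤ L := by
    have : Λ = Λ / (r + 1) * (r + 1) := by field_simp
    nlinarith
  have hle' : Λ ≤ (r + 1) * L := by
    rw [div_le_iff₀ (by positivity)] at hle; linarith
  have hbL : ∀ x, |φ x| ≤ L := fun x => (hMφ x).trans hle
  have hmeas : Measurable φ := phi_meas hr hl
  have hca : ∀ x, x ≠ 0 → ContinuousAt φ x := fun x hx => phi_contAt hr hl hx
  have cP := Pop_cont ha hmeas hbL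
  have cR := Rop_cont hb hmeas hbL
  have cPhi := Phi_cont hr hl
  have cI : Continuous (fun x => ∫ t in (0:ℝ)..x, S t) :=
    intervalIntegral.continuous_primitive (fun a b => S.continuous.intervalIntegrable a b) 0
  have hconst := const_of_deriv (q := fun x => Rop b φ x - Pop a φ x - 2 * Phi r m x +
      ∫ t in (0:ℝ)..x, S t) (by fun_prop) (fun x hx => by
    have d1 := Pop_deriv ha hmeas hbL (hca x hx)
    have d2 := Rop_deriv hb hmeas hbL (hca x hx)
    have d3 := Phi_deriv hr (lip_cont hl) hx
    have d4 : HasDerivAt (fun x => ∫ t in (0:ℝ)..x, S t) (S x) x :=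
      intervalIntegral.integral_hasDerivAt_right (S.continuous.intervalIntegrable _ _)
        (S.continuous.stronglyMeasurableAtFilter _ _) S.continuous.continuousAt
    refine (((d2.fun_sub d1).fun_sub (d3.const_mul 2)).fun_add d4).congr_deriv ?_
    rw [hS x]
    unfold TT Rop
    ring)
  set K := (fun x => Rop b φ x - Pop a φ x - 2 * Phi r m x + ∫ t in (0:ℝ)..x, S t) 0 with hK
  refine ⟨φ, -(r / 2 * K), hmeas, hbL, hca, ?_, ?_⟩
  · intro x y
    rw [mul_phi hr hl, mul_phi hr hl]
    have e1 := hl x y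
    have e2 := Phi_lip hr hl x y
    calc _ = |(m x - m y) - r * (Phi r m x - Phi r m y)| := by congr 1; ring
      _ ≤ |m x - m y| + r * |Phi r m x - Phi r m y| := by
        refine (abs_sub _ _).trans ?_
        rw [abs_mul, abs_of_pos hr]
      _ ≤ Λ * |x - y| + r * (Λ / (r + 1) * |x - y|) := by gcongr
      _ ≤ ((r + 1) * L) * |x - y| + r * (L * |x - y|) := by gcongr
      _ = _ := by ring
  · intro x
    have e := hconst x
    rw [mul_phi hr hl]
    have em : m x = h x + r / 2 * ∫ t in (0:ℝ)..x, S t := rfl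
    rw [em]
    linear_combination (r / 2) * e

theorem y_exp_val {a : ℝ} (ha : 0 < a) :
    ∫ y in Set.Ioi (0:ℝ), y * Real.exp (-a * y) = 1 / a ^ 2 := by
  have := Real.integral_rpow_mul_exp_neg_mul_Ioi (a := 2) (r := a) (by norm_num) ha
  have e : Real.Gamma 2 = 1 := Real.Gamma_two
  rw [e] at this
  calc _ = ∫ t in Set.Ioi (0:ℝ), t ^ ((2:ℝ) - 1) * Real.exp (-(a * t)) := by
        refine setIntegral_congr_fun measurableSet_Ioi fun t _ => ?_
        show _ = t ^ ((2:ℝ) - 1) * Real.exp (-(a * t))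
        rw [show (2:ℝ) - 1 = 1 by norm_num, Real.rpow_one, neg_mul]
    _ = _ := by rw [this, Real.rpow_two]; field_simp

theorem y_exp_int {a : ℝ} (ha : 0 < a) :
    IntegrableOn (fun y => y * Real.exp (-a * y)) (Set.Ioi (0:ℝ)) := by
  by_contra hn
  have := y_exp_val ha
  rw [integral_undef hn] at this
  have : 0 < 1 / a ^ 2 := by positivity
  linarith

theorem xphi_bound {a M Λ : ℝ} (ha : 0 < a) {φ : ℝ → ℝ} (hm : Measurable φ)
    (hb : ∀ x, |φ x| ≤ M) (hl : ∀ x y, |x * φ x - y * φ y| ≤ Λ * |x - y|) (x : ℝ) :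
    |x * φ x - a * (x * Pop a φ x)| ≤ (Λ + M) / a := by
  have i1 := Pop_integrable ha hm hb x 0
  have i2 := (exp_neg_int ha 0).mul_const (a * x * φ x)
  have e : x * φ x - a * (x * Pop a φ x) =
      ∫ y in Set.Ioi (0:ℝ), (Real.exp (-a * y) * (a * x * φ x) -
        (a * x) * (Real.exp (-a * y) * φ (x + y))) := by
    rw [integral_sub i2 (i1.const_mul (a * x)), integral_const_mul, integral_mul_const,
      exp_neg_int_val ha]
    unfold Pop
    field_simp
  rw [e]
  have : ‖∫ y in Set.Ioi (0:ℝ), (Real.exp (-a * y) * (a * x * φ x) -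
        (a * x) * (Real.exp (-a * y) * φ (x + y)))‖ ≤
      ∫ y in Set.Ioi (0:ℝ), (a * (Λ + M)) * (y * Real.exp (-a * y)) := by
    refine norm_integral_le_of_norm_le ((y_exp_int ha).const_mul _) ?_
    refine (ae_restrict_mem measurableSet_Ioi).mono fun y hy => ?_
    have hy' : 0 < y := hy
    have h1 := hl x (x + y)
    rw [show x - (x + y) = -y by ring, abs_neg, abs_of_pos hy'] at h1
    have h2 := hb (x + y)
    calc _ = ‖(a * Real.exp (-a * y)) * ((x * φ x - (x + y) * φ (x + y)) + y * φ (x + y))‖ := by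
          congr 1; ring
      _ = (a * Real.exp (-a * y)) * |(x * φ x - (x + y) * φ (x + y)) + y * φ (x + y)| := by
          rw [norm_mul, Real.norm_eq_abs, Real.norm_eq_abs, abs_of_pos (by positivity)]
      _ ≤ (a * Real.exp (-a * y)) * (Λ * y + y * M) := by
          gcongr
          refine (abs_add_le _ _).trans ?_
          rw [abs_mul, abs_of_pos hy']
          gcongr
      _ = _ := by ring
  rw [integral_const_mul, y_exp_val ha, Real.norm_eq_abs] at this
  calc _ ≤ _ := this
    _ = _ := by field_simp

theorem exists_sol {r α β L : ℝ} (hr : 0 < r) (hβ : |β| < α) {h : ℝ → ℝ}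
    (hlip : ∀ u v : ℝ, |h u - h v| ≤ L * |u - v|) :
    ∃ (f f1 f2 : ℝ → ℝ) (c M : ℝ), Continuous f ∧ Continuous f1 ∧ (∀ x, |f x| ≤ M) ∧
      (∀ x, |f1 x| ≤ M) ∧ (∀ x, x ≠ 0 → HasDerivAt f (f1 x) x) ∧
      (∀ x, x ≠ 0 → HasDerivAt f1 (f2 x) x) ∧
      (∀ x, x * f2 x + (r + 2 * β * x) * f1 x + (r * β + (β ^ 2 - α ^ 2) * x) * f x =
        (α ^ 2 - β ^ 2) * (h x - c)) ∧
      (∀ x, |x * f2 x| ≤ (2 * r + 2) * L * ((α ^ 2 - β ^ 2) / α)) := by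
  have hα : 0 < α := (abs_nonneg β).trans_lt hβ
  obtain ⟨hβ1, hβ2⟩ := abs_lt.1 hβ
  have ha : 0 < α - β := by linarith
  have hb : 0 < α + β := by linarith
  obtain ⟨φ, c, hm, hbd, hca, hl, hode⟩ := exists_phi hr ha hb hlip
  have cP := Pop_cont ha hm hbd
  have cR := Rop_cont hb hm hbd
  have bP := Pop_bound ha hbd
  have bR : ∀ x, |Rop (α + β) φ x| ≤ L / (α + β) := fun x =>
    Pop_bound hb (φ := fun t => φ (-t)) (fun t => hbd (-t)) (-x)
  set a := α - β with hadef
  set b := α + β with hbdef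
  set q := a * b / (a + b) with hq
  have hq0 : 0 < q := by positivity
  have hab : q * (a + b) = a * b := by rw [hq]; field_simp
  have hαab : 2 * α = a + b := by rw [hadef, hbdef]; ring
  have hβab : 2 * β = b - a := by rw [hadef, hbdef]; ring
  have hprod : α ^ 2 - β ^ 2 = a * b := by rw [hadef, hbdef]; ring
  have dP := fun x (hx : x ≠ 0) => Pop_deriv ha hm hbd (hca x hx)
  have dR := fun x (hx : x ≠ 0) => Rop_deriv hb hm hbd (hca x hx)
  have hL : 0 ≤ L := by have := (abs_nonneg _).trans (hlip 1 0); simpa using this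
  refine ⟨fun x => -q * (Pop a φ x + Rop b φ x), fun x => -q * (a * Pop a φ x - b * Rop b φ x),
    fun x => a * b * φ x - q * (a ^ 2 * Pop a φ x + b ^ 2 * Rop b φ x), c,
    q * (L / a + L / b) + q * (a * (L / a) + b * (L / b)), by fun_prop, by fun_prop,
    fun x => ?_, fun x => ?_, fun x hx => ?_, fun x hx => ?_, fun x => ?_, fun x => ?_⟩
  · rw [abs_mul, abs_neg, abs_of_pos hq0]
    have : 0 ≤ q * (a * (L / a) + b * (L / b)) := by positivity
    refine le_add_of_le_of_nonneg ?_ this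
    gcongr
    exact (abs_add_le _ _).trans (add_le_add (bP x) (bR x))
  · rw [abs_mul, abs_neg, abs_of_pos hq0]
    have : 0 ≤ q * (L / a + L / b) := by positivity
    refine le_add_of_nonneg_of_le this ?_
    gcongr
    refine (abs_sub _ _).trans ?_
    rw [abs_mul, abs_mul, abs_of_pos ha, abs_of_pos hb]
    have := bP x
    have := bR x
    gcongr
  · refine (((dP x hx).fun_add (dR x hx)).const_mul (-q)).congr_deriv ?_
    ring
  · refine ((((dP x hx).const_mul a).fun_sub ((dR x hx).const_mul b)).const_mul (-q)).congr_deriv ?_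
    linear_combination (φ x) * hab
  · rw [hprod, show β ^ 2 - α ^ 2 = -(a * b) by linarith, show β = (b - a) / 2 by linarith]
    rw [← hode x]
    linear_combination (r / 2 * (Rop b φ x - Pop a φ x)) * hab
  · have e1 := xphi_bound ha hm hbd hl x
    have e2 := xphi_bound hb (φ := fun t => φ (-t)) (by fun_prop) (fun t => hbd (-t))
      (Λ := (2 * r + 1) * L) (fun x y => by
        have := hl (-x) (-y)
        calc _ = |-x * φ (-x) - -y * φ (-y)| := by rw [← abs_neg]; congr 1; ring
          _ ≤ _ := this
          _ = _ := by rw [show -x - -y = -(x - y) by ring, abs_neg]) (-x)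
    rw [show -x * φ (- -x) - b * (-x * Pop b (fun t => φ (-t)) (-x)) =
      -(x * φ x - b * (x * Rop b φ x)) by rw [neg_neg]; unfold Rop; ring, abs_neg] at e2
    calc |x * (a * b * φ x - q * (a ^ 2 * Pop a φ x + b ^ 2 * Rop b φ x))|
        = |q * (a * (x * φ x - a * (x * Pop a φ x)) + b * (x * φ x - b * (x * Rop b φ x)))| := by
          congr 1
          linear_combination (- (x * φ x)) * hab
      _ ≤ q * (a * |x * φ x - a * (x * Pop a φ x)| + b * |x * φ x - b * (x * Rop b φ x)|) := by
          rw [abs_mul, abs_of_pos hq0]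
          gcongr
          refine (abs_add_le _ _).trans ?_
          rw [abs_mul, abs_mul, abs_of_pos ha, abs_of_pos hb]
      _ ≤ q * (a * (((2 * r + 1) * L + L) / a) + b * (((2 * r + 1) * L + L) / b)) := by gcongr
      _ = (2 * r + 2) * L * ((α ^ 2 - β ^ 2) / α) := by
          rw [hprod, show α = (a + b) / 2 by linarith, hq]
          field_simp
          ring

theorem wI {ν α t : ℝ} (hα : 0 < α) (ht : 0 < t) :
    |t| ^ ν * besselI ν (α * |t|) = (α / 2) ^ ν * (t ^ (2 * ν) * Jf ν (α ^ 2 * t ^ 2 / 4)) := by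
  rw [abs_of_pos ht, besselI_eq ν (by positivity), show α * t / 2 = (α / 2) * t by ring,
    Real.mul_rpow (by positivity) ht.le, show 2 * ν = ν + ν by ring, Real.rpow_add ht,
    show (α * t) ^ 2 / 4 = α ^ 2 * t ^ 2 / 4 by ring]
  ring

theorem wK' {ν α t : ℝ} (hα : 0 < α) (ht : 0 < t) :
    |t| ^ ν * besselK ν (α * |t|) = (1 / 2) * (α / 2) ^ (-ν) * kap ν (α ^ 2 * t ^ 2 / 4) := by
  rw [abs_of_pos ht, besselK_eq ν (by positivity), show α * t / 2 = (α / 2) * t by ring,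
    Real.mul_rpow (by positivity) ht.le,
    show (α * t) ^ 2 / 4 = α ^ 2 * t ^ 2 / 4 by ring]
  have : t ^ ν * t ^ (-ν) = 1 := by rw [← Real.rpow_add ht]; simp
  linear_combination (1 / 2 * (α / 2) ^ (-ν) * kap ν (α ^ 2 * t ^ 2 / 4)) * this

theorem wK {ν α t : ℝ} (hα : 0 < α) (ht : t ≠ 0) :
    |t| ^ ν * besselK ν (α * |t|) = (1 / 2) * (α / 2) ^ (-ν) * kap ν (α ^ 2 * t ^ 2 / 4) := by
  have := wK' (ν := ν) hα (abs_pos.2 ht)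
  rwa [abs_abs, sq_abs] at this

theorem wI0 {ν α t : ℝ} (hα : 0 < α) (ht : 0 < t) :
    besselI ν (α * |t|) / |t| ^ ν = (α / 2) ^ ν * Jf ν (α ^ 2 * t ^ 2 / 4) := by
  rw [abs_of_pos ht, besselI_eq ν (by positivity), show α * t / 2 = (α / 2) * t by ring,
    Real.mul_rpow (by positivity) ht.le,
    show (α * t) ^ 2 / 4 = α ^ 2 * t ^ 2 / 4 by ring]
  have : 0 < t ^ ν := Real.rpow_pos_of_pos ht _
  field_simp

theorem wK0 {ν α t : ℝ} (hα : 0 < α) (ht : 0 < t) :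
    besselK ν (α * |t|) / |t| ^ ν =
      (1 / 2) * (α / 2) ^ (-ν) * (t ^ (-(2 * ν)) * kap ν (α ^ 2 * t ^ 2 / 4)) := by
  rw [abs_of_pos ht, besselK_eq ν (by positivity), show α * t / 2 = (α / 2) * t by ring,
    Real.mul_rpow (by positivity) ht.le, show -(2 * ν) = -ν + -ν by ring, Real.rpow_add ht,
    show (α * t) ^ 2 / 4 = α ^ 2 * t ^ 2 / 4 by ring, div_eq_mul_inv, ← Real.rpow_neg ht.le]
  ring

/-- The Stein solution formula with free parameters. -/
noncomputable def solF (ν α β k : ℝ) (η : ℝ → ℝ) (x : ℝ) : ℝ :=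
  -(Real.exp (-β * x) * besselK ν (α * |x|) / (k * |x| ^ ν)) *
    (∫ t in (0:ℝ)..x, Real.exp (β * t) * |t| ^ ν * besselI ν (α * |t|) * η t) -
  (Real.exp (-β * x) * besselI ν (α * |x|) / (k * |x| ^ ν)) *
    (∫ t in Set.Ioi x, Real.exp (β * t) * |t| ^ ν * besselK ν (α * |t|) * η t)

theorem solF_pos {ν α β r M C D k : ℝ} {f f1 f2 H η : ℝ → ℝ}
    (S : HalfLine ν α β r M C D f f1 f2 H) (hk : 0 < k) (hη : ∀ t, η t = k * H t) {x : ℝ}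
    (hx : 0 < x) : solF ν α β k η x = f x := by
  have hα := S.hα
  unfold solF
  have e1 : ∫ t in (0:ℝ)..x, Real.exp (β * t) * |t| ^ ν * besselI ν (α * |t|) * η t =
      (k * (α / 2) ^ ν) * ∫ t in (0:ℝ)..x,
        Real.exp (β * t) * t ^ (2 * ν) * Jf ν (α ^ 2 * t ^ 2 / 4) * H t := by
    rw [← intervalIntegral.integral_const_mul]
    refine intervalIntegral.integral_congr_ae (ae_of_all _ fun t ht => ?_)
    rw [Set.uIoc_of_le hx.le] at ht
    rw [mul_assoc (Real.exp (β * t)), wI hα ht.1, hη]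
    ring
  have e2 : ∫ t in Set.Ioi x, Real.exp (β * t) * |t| ^ ν * besselK ν (α * |t|) * η t =
      (k * ((1 / 2) * (α / 2) ^ (-ν))) * ∫ t in Set.Ioi x,
        Real.exp (β * t) * kap ν (α ^ 2 * t ^ 2 / 4) * H t := by
    rw [← integral_const_mul]
    refine setIntegral_congr_fun measurableSet_Ioi fun t ht => ?_
    have ht' : 0 < t := hx.trans ht
    show Real.exp (β * t) * |t| ^ ν * besselK ν (α * |t|) * η t = _
    rw [mul_assoc (Real.exp (β * t)), wK hα ht'.ne', hη]
    ring
  rw [e1, e2]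
  have e3 : Real.exp (-β * x) * besselK ν (α * |x|) / (k * |x| ^ ν) = Real.exp (-β * x) / k *
      (besselK ν (α * |x|) / |x| ^ ν) := by ring
  have e4 : Real.exp (-β * x) * besselI ν (α * |x|) / (k * |x| ^ ν) = Real.exp (-β * x) / k *
      (besselI ν (α * |x|) / |x| ^ ν) := by ring
  rw [e3, e4, wK0 hα hx, wI0 hα hx]
  have hrec := S.recover hx
  have hp : (α / 2) ^ ν * (α / 2) ^ (-ν) = 1 := by
    rw [← Real.rpow_add (by positivity)]; simp
  have hE : Real.exp (-β * x) * Real.exp (β * x) = 1 := by rw [← Real.exp_add]; simp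
  set I1 := ∫ t in (0:ℝ)..x, Real.exp (β * t) * t ^ (2 * ν) * Jf ν (α ^ 2 * t ^ 2 / 4) * H t
  set I2 := ∫ t in Set.Ioi x, Real.exp (β * t) * kap ν (α ^ 2 * t ^ 2 / 4) * H t
  have hk' : k⁻¹ * k = 1 := inv_mul_cancel₀ hk.ne'
  calc _ = (k⁻¹ * k) * ((α / 2) ^ ν * (α / 2) ^ (-ν)) * Real.exp (-β * x) *
      (-(1/2) * (x ^ (-(2 * ν)) * kap ν (α ^ 2 * x ^ 2 / 4) * I1 +
        Jf ν (α ^ 2 * x ^ 2 / 4) * I2)) := by ring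
    _ = f x := by rw [hrec, hk', hp]; linear_combination (f x) * hE

theorem solF_neg {ν α β k : ℝ} {η : ℝ → ℝ} {x : ℝ}
    (hi : Integrable (fun t => Real.exp (β * t) * |t| ^ ν * besselK ν (α * |t|) * η t))
    (h0 : ∫ t, Real.exp (β * t) * |t| ^ ν * besselK ν (α * |t|) * η t = 0) :
    solF ν α β k η (-x) = - solF ν α (-β) k (fun t => η (-t)) x := by
  unfold solF
  have e1 : ∫ t in (0:ℝ)..(-x), Real.exp (β * t) * |t| ^ ν * besselI ν (α * |t|) * η t =
      - ∫ t in (0:ℝ)..x, Real.exp (-β * t) * |t| ^ ν * besselI ν (α * |t|) * η (-t) := by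
    have := intervalIntegral.integral_comp_neg (a := 0) (b := x)
      (fun t => Real.exp (β * t) * |t| ^ ν * besselI ν (α * |t|) * η t)
    rw [neg_zero] at this
    rw [intervalIntegral.integral_symm, ← this]
    simp
  have e2 : ∫ t in Set.Ioi (-x), Real.exp (β * t) * |t| ^ ν * besselK ν (α * |t|) * η t =
      - ∫ t in Set.Ioi x, Real.exp (-β * t) * |t| ^ ν * besselK ν (α * |t|) * η (-t) := by
    have h1 := integral_comp_neg_Ioi x
      (fun t => Real.exp (β * t) * |t| ^ ν * besselK ν (α * |t|) * η t)
    have h2 := integral_add_compl (measurableSet_Ioi (a := -x)) hi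
    rw [h0, Set.compl_Ioi, ← h1] at h2
    simp only [abs_neg, mul_neg] at h2
    simp only [neg_mul]
    linarith
  rw [e1, e2, abs_neg]
  simp only [neg_mul, mul_neg, neg_neg]
  ring

theorem vg_eq {r θ σ t : ℝ} (hσ : 0 < σ) (ht : t ≠ 0) :
    vgDensity r θ σ t = ((σ * √π * Real.Gamma (r / 2))⁻¹ * (1 / 2) *
      (σ ^ 2 / (θ ^ 2 + σ ^ 2)) ^ ((r - 1) / 2)) *
      (Real.exp (θ / σ ^ 2 * t) * kap ((r - 1) / 2) ((√(θ ^ 2 + σ ^ 2) / σ ^ 2) ^ 2 * t ^ 2 / 4)) := by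
  have hs : 0 < √(θ ^ 2 + σ ^ 2) := Real.sqrt_pos.2 (by positivity)
  set s := √(θ ^ 2 + σ ^ 2) with hsdef
  have hs2 : s ^ 2 = θ ^ 2 + σ ^ 2 := Real.sq_sqrt (by positivity)
  have ht' : 0 < |t| := abs_pos.2 ht
  unfold vgDensity
  rw [← hsdef, show θ * t / σ ^ 2 = θ / σ ^ 2 * t by ring,
    show s * |t| / σ ^ 2 = s / σ ^ 2 * |t| by ring]
  have hk := wK (ν := (r - 1) / 2) (α := s / σ ^ 2) (by positivity) ht
  have e : (|t| / (2 * s)) ^ ((r - 1) / 2) = |t| ^ ((r - 1) / 2) * (1 / (2 * s)) ^ ((r - 1) / 2) := by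
    rw [← Real.mul_rpow (by positivity) (by positivity)]; congr 1; ring
  have e2 : (s / σ ^ 2 / 2) ^ (-((r - 1) / 2)) * (1 / (2 * s)) ^ ((r - 1) / 2) =
      (σ ^ 2 / (θ ^ 2 + σ ^ 2)) ^ ((r - 1) / 2) := by
    rw [Real.rpow_neg (by positivity), ← Real.inv_rpow (by positivity),
      ← Real.mul_rpow (by positivity) (by positivity), ← hs2]
    congr 1
    field_simp
  rw [e, ← e2]
  linear_combination ((σ * √π * Real.Gamma (r / 2))⁻¹ * Real.exp (θ / σ ^ 2 * t) *
    (1 / (2 * s)) ^ ((r - 1) / 2)) * hk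

theorem mean_eq {r θ σ c : ℝ} (hr : 0 < r) (hσ : 0 < σ) {h : ℝ → ℝ}
    (hi : Integrable (fun t => Real.exp (θ / σ ^ 2 * t) *
      kap ((r - 1) / 2) ((√(θ ^ 2 + σ ^ 2) / σ ^ 2) ^ 2 * t ^ 2 / 4) * (h t - c)))
    (h0 : ∫ t, Real.exp (θ / σ ^ 2 * t) *
      kap ((r - 1) / 2) ((√(θ ^ 2 + σ ^ 2) / σ ^ 2) ^ 2 * t ^ 2 / 4) * (h t - c) = 0)
    (hβ : |θ / σ ^ 2| < √(θ ^ 2 + σ ^ 2) / σ ^ 2) :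
    ∫ t, h t * vgDensity r θ σ t = c := by
  have hs : 0 < √(θ ^ 2 + σ ^ 2) := Real.sqrt_pos.2 (by positivity)
  obtain ⟨hw, hv⟩ := kap_normal (ν := (r - 1) / 2) (by linarith)
    (by positivity : 0 < √(θ ^ 2 + σ ^ 2) / σ ^ 2) hβ
  set s := √(θ ^ 2 + σ ^ 2) with hsdef
  have hs2 : s ^ 2 = θ ^ 2 + σ ^ 2 := Real.sq_sqrt (by positivity)
  set N := (σ * √π * Real.Gamma (r / 2))⁻¹ * (1 / 2) *
      (σ ^ 2 / (θ ^ 2 + σ ^ 2)) ^ ((r - 1) / 2) with hN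
  set w := fun t : ℝ => Real.exp (θ / σ ^ 2 * t) *
      kap ((r - 1) / 2) ((s / σ ^ 2) ^ 2 * t ^ 2 / 4) with hwdef
  have hne : ∀ᵐ t : ℝ, t ≠ 0 := by
    simp [ae_iff]
  have e1 : ∫ t, h t * vgDensity r θ σ t = ∫ t, N * (w t * (h t - c) + c * w t) := by
    refine integral_congr_ae ?_
    filter_upwards [hne] with t ht
    rw [vg_eq hσ ht, ← hsdef]
    simp only [hwdef, hN]
    ring
  rw [e1, integral_const_mul, integral_add hi (hw.const_mul c), h0, zero_add, integral_const_mul, hv]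
  have hG : 0 < Real.Gamma (r / 2) := Real.Gamma_pos_of_pos (by positivity)
  have e2 : 1 / (1 - (θ / σ ^ 2) ^ 2 / (s / σ ^ 2) ^ 2) = (σ ^ 2 / (θ ^ 2 + σ ^ 2))⁻¹ := by
    have : 1 - (θ / σ ^ 2) ^ 2 / (s / σ ^ 2) ^ 2 = σ ^ 2 / (θ ^ 2 + σ ^ 2) := by
      rw [← hs2]; field_simp; linarith
    rw [this, one_div]
  have hq : 0 < σ ^ 2 / (θ ^ 2 + σ ^ 2) := by positivity
  rw [e2, show (r - 1) / 2 + 1 / 2 = r / 2 by ring, Real.inv_rpow hq.le, hN]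
  have e3 : (σ ^ 2 / (θ ^ 2 + σ ^ 2)) ^ (r / 2) =
      (σ ^ 2 / (θ ^ 2 + σ ^ 2)) ^ ((r - 1) / 2) * (σ / s) := by
    have : σ / s = (σ ^ 2 / (θ ^ 2 + σ ^ 2)) ^ ((1:ℝ) / 2) := by
      rw [← Real.sqrt_eq_rpow, ← hs2, ← div_pow, Real.sqrt_sq (by positivity)]
    rw [this, ← Real.rpow_add hq]
    congr 1; ring
  rw [e3]
  have hp : 0 < (σ ^ 2 / (θ ^ 2 + σ ^ 2)) ^ ((r - 1) / 2) := Real.rpow_pos_of_pos hq _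
  have hpi : 0 < √π := Real.sqrt_pos.2 Real.pi_pos
  generalize (σ ^ 2 / (θ ^ 2 + σ ^ 2)) ^ ((r - 1) / 2) = p at hp
  field_simp

theorem identify {r θ σ L : ℝ} (hr : 0 < r) (hσ : 0 < σ) {h : ℝ → ℝ}
    (hlip : ∀ u v : ℝ, |h u - h v| ≤ L * |u - v|) :
    ∃ f1 f2 : ℝ → ℝ, (∀ x, x ≠ 0 → HasDerivAt (steinSolution r θ σ h) (f1 x) x) ∧
      (∀ x, x ≠ 0 → HasDerivAt f1 (f2 x) x) ∧
      ∀ x, |x * f2 x| ≤ (2 * r + 2) * L * (1 / √(θ ^ 2 + σ ^ 2)) := by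
  have hs : 0 < √(θ ^ 2 + σ ^ 2) := Real.sqrt_pos.2 (by positivity)
  have hβ : |θ / σ ^ 2| < √(θ ^ 2 + σ ^ 2) / σ ^ 2 := by
    rw [abs_div, abs_of_pos (by positivity : 0 < σ ^ 2)]
    gcongr
    refine Real.lt_sqrt_of_sq_lt ?_
    rw [sq_abs]
    have : 0 < σ ^ 2 := by positivity
    linarith
  set s := √(θ ^ 2 + σ ^ 2) with hsdef
  have hs2 : s ^ 2 = θ ^ 2 + σ ^ 2 := Real.sq_sqrt (by positivity)
  set ν := (r - 1) / 2 with hνdef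
  set α := s / σ ^ 2 with hαdef
  set β := θ / σ ^ 2 with hβdef
  have hα : 0 < α := by positivity
  have hk : α ^ 2 - β ^ 2 = 1 / σ ^ 2 := by
    rw [hαdef, hβdef, div_pow, hs2]; field_simp; ring
  obtain ⟨f, f1, f2, c, M, cf, cf1, bf, bf1, d1, d2, ode, bd⟩ := exists_sol hr hβ hlip
  have ch := lip_cont hlip
  set H : ℝ → ℝ := fun x => (α ^ 2 - β ^ 2) * (h x - c) with hH
  have hk0 : 0 < α ^ 2 - β ^ 2 := by rw [hk]; positivity
  have bH : ∀ t, |H t| ≤ (α ^ 2 - β ^ 2) * |h 0 - c| + (α ^ 2 - β ^ 2) * L * |t| := by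
    intro t
    have := hlip t 0
    rw [sub_zero] at this
    rw [hH]
    simp only []
    rw [abs_mul, abs_of_pos hk0, mul_assoc, ← mul_add]
    gcongr
    calc |h t - c| = |(h 0 - c) + (h t - h 0)| := by congr 1; ring
      _ ≤ |h 0 - c| + |h t - h 0| := abs_add_le _ _
      _ ≤ _ := by gcongr
  have SP : HalfLine ν α β r M ((α ^ 2 - β ^ 2) * |h 0 - c|) ((α ^ 2 - β ^ 2) * L) f f1 f2 H :=
    { hν := by rw [hνdef]; linarith
      hα := hα
      hβ := hβ
      hr := by rw [hνdef]; ring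
      cf := cf
      cf1 := cf1
      bf := bf
      bf1 := bf1
      d1 := fun x hx => d1 x hx.ne'
      d2 := fun x hx => d2 x hx.ne'
      cH := by rw [hH]; fun_prop
      bH := bH
      ode := fun x _ => ode x }
  have SN : HalfLine ν α (-β) r M ((α ^ 2 - β ^ 2) * |h 0 - c|) ((α ^ 2 - β ^ 2) * L)
      (fun x => -f (-x)) (fun x => f1 (-x)) (fun x => -f2 (-x)) (fun x => H (-x)) :=
    { hν := by rw [hνdef]; linarith
      hα := hα
      hβ := by rwa [abs_neg]
      hr := by rw [hνdef]; ring
      cf := by fun_prop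
      cf1 := by fun_prop
      bf := fun x => by rw [abs_neg]; exact bf _
      bf1 := fun x => bf1 _
      d1 := fun x hx => by
        have := HasDerivAt.comp (h₂ := f) (h := fun t : ℝ => -t) x (d1 (-x) (by linarith)) (hasDerivAt_neg x)
        exact this.fun_neg.congr_deriv (by ring)
      d2 := fun x hx => by
        have := HasDerivAt.comp (h₂ := f1) (h := fun t : ℝ => -t) x (d2 (-x) (by linarith)) (hasDerivAt_neg x)
        exact this.congr_deriv (by ring)
      cH := by rw [hH]; fun_prop
      bH := fun t => by simpa using bH (-t)
      ode := fun x _ => by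
        have := ode (-x)
        simp only [hH]
        rw [← this]
        ring }
  have iH : Integrable (fun t => Real.exp (β * t) * kap ν (α ^ 2 * t ^ 2 / 4) * H t) := by
    rw [← integrableOn_univ]
    exact SP.integrableH MeasurableSet.univ
  have zH : ∫ t, Real.exp (β * t) * kap ν (α ^ 2 * t ^ 2 / 4) * H t = 0 := by
    have h1 := integral_comp_neg_Ioi 0
      (fun t => Real.exp (β * t) * kap ν (α ^ 2 * t ^ 2 / 4) * H t)
    have h2 := integral_add_compl (measurableSet_Ioi (a := (0:ℝ))) iH
    have h3 := SN.intC
    rw [Set.compl_Ioi, SP.intC] at h2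
    rw [neg_zero] at h1
    rw [← h1] at h2
    simp only [neg_sq, mul_neg, neg_mul, neg_zero] at h2 h3
    rw [h3] at h2
    linarith
  have hkσ : ∀ t, h t - c = σ ^ 2 * H t := by
    intro t
    rw [hH]; simp only [hk]; field_simp
  have hmean : ∫ t, h t * vgDensity r θ σ t = c := by
    refine mean_eq hr hσ ?_ ?_ hβ
    · refine (iH.const_mul (σ ^ 2)).congr (ae_of_all _ fun t => ?_)
      show _ = Real.exp (β * t) * kap ν (α ^ 2 * t ^ 2 / 4) * (h t - c)
      rw [hkσ]; ring
    · have := integral_const_mul (μ := volume) (σ ^ 2) (fun t => Real.exp (β * t) * kap ν (α ^ 2 * t ^ 2 / 4) * H t)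
      rw [zH, mul_zero] at this
      rw [← this]
      congr 1; ext t
      show Real.exp (β * t) * kap ν (α ^ 2 * t ^ 2 / 4) * (h t - c) = _
      rw [hkσ]; ring
  have htil : htilde r θ σ h = fun t => h t - c := by
    ext t; unfold htilde; rw [hmean]
  have hst : ∀ x, steinSolution r θ σ h x = solF ν α β (σ ^ 2) (fun t => h t - c) x := by
    intro x
    unfold steinSolution solF
    rw [htil]
  have hne : ∀ᵐ t : ℝ, t ≠ 0 := by
    simp [ae_iff]
  have eK : (fun t => (σ ^ 2 * ((1 / 2) * (α / 2) ^ (-ν))) *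
      (Real.exp (β * t) * kap ν (α ^ 2 * t ^ 2 / 4) * H t)) =ᵐ[volume]
      (fun t => Real.exp (β * t) * |t| ^ ν * besselK ν (α * |t|) * (h t - c)) := by
    filter_upwards [hne] with t ht
    rw [mul_assoc (Real.exp (β * t)) (|t| ^ ν), wK hα ht, hkσ]
    ring
  have hiK := (iH.const_mul (σ ^ 2 * ((1 / 2) * (α / 2) ^ (-ν)))).congr eK
  have h0K : ∫ t, Real.exp (β * t) * |t| ^ ν * besselK ν (α * |t|) * (h t - c) = 0 := by
    rw [← integral_congr_ae eK, integral_const_mul, zH, mul_zero]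
  have hsol : ∀ x, x ≠ 0 → steinSolution r θ σ h x = f x := by
    intro x hx
    rw [hst]
    rcases lt_or_gt_of_ne hx with hx' | hx'
    · have e := solF_neg (k := σ ^ 2) (x := -x) hiK h0K
      rw [neg_neg] at e
      rw [e, solF_pos SN (by positivity) (fun t => hkσ (-t)) (by linarith : 0 < -x)]
      simp
    · exact solF_pos SP (by positivity) hkσ hx'
  refine ⟨f1, f2, fun x hx => (d1 x hx).congr_of_eventuallyEq ?_, d2, fun x => ?_⟩
  · filter_upwards [isOpen_ne.mem_nhds hx] with y hy using hsol y hy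
  · refine (bd x).trans (le_of_eq ?_)
    rw [hk, hαdef]
    field_simp

theorem final_ineq {r θ σ : ℝ} (hr : 0 < r) (hσ : 0 < σ) :
    (2 * r + 2) * (1 / √(θ ^ 2 + σ ^ 2)) ≤ (2 * Real.sqrt (θ ^ 2 + σ ^ 2) / σ ^ 2) *
          (1 + 6 / (r + 1) + Bconst (r + 1) θ σ) *
          (1 + (2 + θ ^ 2 / σ ^ 2) * Cconst r θ σ) := by
  have hs : 0 < √(θ ^ 2 + σ ^ 2) := Real.sqrt_pos.2 (by positivity)
  have hs2 : √(θ ^ 2 + σ ^ 2) ^ 2 = θ ^ 2 + σ ^ 2 := Real.sq_sqrt (by positivity)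
  set s := √(θ ^ 2 + σ ^ 2) with hsdef
  have hτ : 0 ≤ θ ^ 2 / σ ^ 2 := by positivity
  have hA : 0 ≤ Aconst r θ σ := by
    unfold Aconst
    have : 0 < Real.Gamma (r / 2) := Real.Gamma_pos_of_pos (by positivity)
    split_ifs <;> positivity
  have hB : 0 ≤ Bconst (r + 1) θ σ := by
    unfold Bconst
    split_ifs <;> positivity
  have hC6 : 6 + 2 * r * Aconst r θ σ ≤ Cconst r θ σ := by
    unfold Cconst
    have h1 : 0 ≤ 2 * Real.sqrt 2 / Real.sqrt r := by positivity
    have h2 : 0 ≤ 2 * Real.sqrt (2 * Real.pi * (r + 1)) * (|θ| / σ) * (1 + θ ^ 2 / σ ^ 2) ^ ((r - 1) / 2) := by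
      positivity
    have h3 : 0 ≤ 2 * Real.sqrt (2 * r) * Aconst r θ σ := by positivity
    nlinarith
  have hC0 : 6 ≤ Cconst r θ σ := by
    have : 0 ≤ 2 * r * Aconst r θ σ := by positivity
    linarith
  have hs1 : 1 / s ≤ s / σ ^ 2 := by
    rw [div_le_div_iff₀ hs (by positivity)]
    nlinarith [sq_nonneg θ]
  have key : r + 1 ≤ (1 + 6 / (r + 1) + Bconst (r + 1) θ σ) *
      (1 + (2 + θ ^ 2 / σ ^ 2) * Cconst r θ σ) := by
    have h6 : 0 ≤ 6 / (r + 1) := by positivity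
    have hC2 : 1 + 2 * Cconst r θ σ ≤ 1 + (2 + θ ^ 2 / σ ^ 2) * Cconst r θ σ := by
      nlinarith
    rcases lt_or_ge r 2 with h2 | h2
    · calc r + 1 ≤ 1 * (1 + 2 * Cconst r θ σ) := by linarith
        _ ≤ _ := by gcongr; linarith
    · set q := √r with hq
      have hq0 : 0 < q := Real.sqrt_pos.2 hr
      have hqq : q ^ 2 = r := Real.sq_sqrt hr.le
      have hB2 : q ≤ Bconst (r + 1) θ σ := by
        unfold Bconst
        rw [if_pos (by linarith)]
        have e1 : q ≤ √(π * (r + 1 - 1) / 2) := by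
          apply Real.sqrt_le_sqrt
          nlinarith [Real.pi_gt_three]
        have e2 : 1 ≤ (1 + θ ^ 2 / σ ^ 2) ^ ((r + 1) / 2 - 1) :=
          Real.one_le_rpow (by linarith) (by linarith)
        calc q = q * 1 := (mul_one q).symm
          _ ≤ _ := by gcongr
      have hA2 : 1 / q ≤ Aconst r θ σ := by
        unfold Aconst
        rw [if_pos h2]
        have e2 : 1 ≤ (1 + θ ^ 2 / σ ^ 2) ^ (r / 2) :=
          Real.one_le_rpow (by linarith) (by linarith)
        have e3 : √(2 * r - 1) ≤ 2 * q := by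
          apply Real.sqrt_le_iff.2 ⟨by positivity, ?_⟩
          nlinarith
        have e4 : 1 ≤ √π := Real.one_le_sqrt.2 (by linarith [Real.pi_gt_three])
        have e5 : 0 < √(2 * r - 1) := Real.sqrt_pos.2 (by linarith)
        calc 1 / q = 2 * 1 / (2 * q) * 1 := by field_simp
          _ ≤ _ := by gcongr
      have hC3 : 2 * q ≤ Cconst r θ σ := by
        have : 2 * r * (1 / q) ≤ 2 * r * Aconst r θ σ := by gcongr
        have e : 2 * r * (1 / q) = 2 * q := by rw [← hqq]; field_simp
        linarith
      calc r + 1 ≤ (1 + q) * (1 + 2 * (2 * q)) := by nlinarith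
        _ ≤ (1 + 6 / (r + 1) + Bconst (r + 1) θ σ) * (1 + 2 * Cconst r θ σ) := by
          gcongr
          linarith
        _ ≤ _ := by gcongr
  have h0 : 0 ≤ (1 + 6 / (r + 1) + Bconst (r + 1) θ σ) *
      (1 + (2 + θ ^ 2 / σ ^ 2) * Cconst r θ σ) := by linarith
  calc (2 * r + 2) * (1 / s) = 2 * ((r + 1) * (1 / s)) := by ring
    _ ≤ 2 * (((1 + 6 / (r + 1) + Bconst (r + 1) θ σ) *
      (1 + (2 + θ ^ 2 / σ ^ 2) * Cconst r θ σ)) * (s / σ ^ 2)) := by gcongr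
    _ = _ := by ring

theorem stein_factor_xf''_lipschitz (r θ σ : ℝ) (hr : 0 < r) (hσ : 0 < σ)
    (h : ℝ → ℝ) (L : ℝ) (hL : 0 ≤ L) (hlip : ∀ u v : ℝ, |h u - h v| ≤ L * |u - v|) :
    ∀ x : ℝ, x ≠ 0 → ∀ g : ℝ → ℝ,
      (∀ᶠ y in nhds x, y ≠ 0 → HasDerivAt (steinSolution r θ σ h) (g y) y) →
      ∀ d : ℝ, HasDerivAt g d x →
      |x * d| ≤ (2 * Real.sqrt (θ ^ 2 + σ ^ 2) / σ ^ 2) *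
          (1 + 6 / (r + 1) + Bconst (r + 1) θ σ) *
          (1 + (2 + θ ^ 2 / σ ^ 2) * Cconst r θ σ) * L := by
  intro x hx g hg d hd
  obtain ⟨f1, f2, d1, d2, bd⟩ := identify (θ := θ) hr hσ hlip
  have e : g =ᶠ[nhds x] f1 := by
    filter_upwards [hg, isOpen_ne.mem_nhds hx] with y hy hy0
    exact (hy hy0).unique (d1 y hy0)
  have hd' : d = f2 x := (hd.congr_of_eventuallyEq e.symm).unique (d2 x hx)
  rw [hd']
  refine (bd x).trans ?_
  have := mul_le_mul_of_nonneg_right (final_ineq (θ := θ) hr hσ) hL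
  calc _ = (2 * r + 2) * (1 / √(θ ^ 2 + σ ^ 2)) * L := by ring
    _ ≤ _ := this
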